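/- arXiv:0902.0640 — 9 statements merged into one kernel-verified Lean document; each statement's English description precedes it below -/
import Mathlib

section
/- If X is a convex-transitive Banach space and there exists a uniformly big point x ∈ S_X, then every y ∈ S_X is a uniformly big point. -/
open Metric Filter

/-- The set `C_n(x)` of convex combinations `∑ aᵢ Tᵢ(x)` of images of `x` under
rotations (surjective linear isometries) of `X`, with `aᵢ ∈ [0,1]`, `∑ aᵢ = 1`. -/
def convexComb (𝕜 : Type*) [RCLike 𝕜] {X : Type*} [NormedAddCommGroup X] [NormedSpace 𝕜 X]
    (n : ℕ) (x : X) : Set X :=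
  {z | ∃ (T : Fin n → (X ≃ₗᵢ[𝕜] X)) (a : Fin n → ℝ),
    (∀ i, a i ∈ Set.Icc (0:ℝ) 1) ∧ (∑ i, a i = 1) ∧ z = ∑ i, ((a i : 𝕜) • T i x)}

/-- The orbit `G_X(x)` of `x` under the group of rotations of `X`. -/
def rotationOrbit (𝕜 : Type*) [RCLike 𝕜] {X : Type*} [NormedAddCommGroup X]
    [NormedSpace 𝕜 X] (x : X) : Set X :=
  {y | ∃ T : X ≃ₗᵢ[𝕜] X, T x = y}

/-- `X` is convex-transitive if the closed convex hull of each orbit `G_X(x)`, `x ∈ S_X`,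
(i.e. the closure of the set of all finite convex combinations of elements of the orbit)
is the closed unit ball. -/
def ConvexTransitive (𝕜 : Type*) [RCLike 𝕜] (X : Type*) [NormedAddCommGroup X]
    [NormedSpace 𝕜 X] : Prop :=
  ∀ x ∈ sphere (0:X) 1, closure (⋃ n : ℕ, convexComb 𝕜 n x) = closedBall (0:X) 1

/-- `x ∈ S_X` is a uniformly big point if `sup_{y ∈ B_X} dist (y, C_n x) → 0` as `n → ∞`. -/
def UniformlyBigPoint (𝕜 : Type*) [RCLike 𝕜] {X : Type*} [NormedAddCommGroup X]
    [NormedSpace 𝕜 X] (x : X) : Prop :=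
  Tendsto (fun n : ℕ =>
      ⨆ y : closedBall (0:X) 1, Metric.infDist (y : X) (convexComb 𝕜 n x))
    atTop (nhds 0)

section ConvexComb

variable {𝕜 : Type*} [RCLike 𝕜] {X : Type*} [NormedAddCommGroup X] [NormedSpace 𝕜 X]

theorem sum_mem_convexComb {ι : Type*} [Fintype ι] {n : ℕ} (hn : Fintype.card ι ≤ n) (x : X)
    (T : ι → (X ≃ₗᵢ[𝕜] X)) (a : ι → ℝ) (ha : ∀ i, 0 ≤ a i) (hsum : ∑ i, a i = 1) :
    ∑ i, (a i : 𝕜) • T i x ∈ convexComb 𝕜 n x := by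
  obtain ⟨e⟩ : Nonempty (ι ↪ Fin n) := Function.Embedding.nonempty_of_card_le (by simpa using hn)
  have hb : ∀ j, j ∉ Set.range e → Function.extend e a 0 j = 0 := fun j hj =>
    Function.extend_apply' _ _ _ hj
  have hb_nonneg : ∀ j, 0 ≤ Function.extend e a 0 j := by
    intro j
    by_cases hj : j ∈ Set.range e
    · obtain ⟨i, rfl⟩ := hj
      simpa [e.injective.extend_apply] using ha i
    · exact (hb j hj).ge
  have hb_sum : ∑ j, Function.extend e a 0 j = 1 := by
    rw [← hsum]
    exact (Fintype.sum_of_injective e e.injective _ _ hb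
      fun i => (e.injective.extend_apply _ _ i).symm).symm
  refine ⟨Function.extend e T fun _ => LinearIsometryEquiv.refl 𝕜 X, Function.extend e a 0,
    fun j => ⟨hb_nonneg j, ?_⟩, hb_sum, ?_⟩
  · rw [← hb_sum]
    exact Finset.single_le_sum (fun i _ => hb_nonneg i) (Finset.mem_univ j)
  · refine Fintype.sum_of_injective e e.injective _ _ (fun j hj => ?_) fun i => ?_
    · simp [hb j hj]
    · simp [e.injective.extend_apply]

theorem self_mem_convexComb {n : ℕ} (hn : 1 ≤ n) (x : X) : x ∈ convexComb 𝕜 n x := by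
  simpa using sum_mem_convexComb (ι := Unit) (by simpa using hn) x
    (fun _ => LinearIsometryEquiv.refl 𝕜 X) (fun _ => 1) (by simp) (by simp)

/-- If `w ∈ C_k(y)` is close to `x`, then points of `C_m(x)` are equally close to `C_n(y)` as soon
as `m * k ≤ n`. -/
theorem exists_mem_convexComb_dist_le {m k n : ℕ} (hn : m * k ≤ n) {x y w v : X}
    (hw : w ∈ convexComb 𝕜 k y) (hv : v ∈ convexComb 𝕜 m x) :
    ∃ u ∈ convexComb 𝕜 n y, dist v u ≤ dist x w := by
  obtain ⟨S, b, hb, hb_sum, rfl⟩ := hw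
  obtain ⟨T, a, ha, ha_sum, rfl⟩ := hv
  refine ⟨_, sum_mem_convexComb (ι := Fin m × Fin k) (by simpa using hn) y
    (fun p => (S p.2).trans (T p.1)) (fun p => a p.1 * b p.2)
    (fun p => mul_nonneg (ha p.1).1 (hb p.2).1) ?_, ?_⟩
  · simp [Fintype.sum_prod_type, ← Finset.mul_sum, hb_sum, ha_sum]
  · have h : ∑ p : Fin m × Fin k, ((a p.1 * b p.2 : ℝ) : 𝕜) • ((S p.2).trans (T p.1)) y =
        ∑ i, (a i : 𝕜) • T i (∑ j, (b j : 𝕜) • S j y) := by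
      simp [Fintype.sum_prod_type, map_sum, Finset.smul_sum, mul_smul]
    rw [h]
    calc _ ≤ ∑ i, dist ((a i : 𝕜) • T i x) ((a i : 𝕜) • T i (∑ j, (b j : 𝕜) • S j y)) :=
          dist_sum_sum_le _ _ _
      _ = ∑ i, a i * dist x (∑ j, (b j : 𝕜) • S j y) := by
          refine Finset.sum_congr rfl fun i _ => ?_
          rw [dist_smul₀, LinearIsometryEquiv.dist_map, RCLike.norm_ofReal,
            abs_of_nonneg (ha i).1]
      _ = _ := by rw [← Finset.sum_mul, ha_sum, one_mul]

theorem bddAbove_range_infDist_convexComb {n : ℕ} (hn : 1 ≤ n) (x : X) :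
    BddAbove (Set.range fun y : closedBall (0 : X) 1 => infDist (y : X) (convexComb 𝕜 n x)) := by
  refine ⟨1 + ‖x‖, ?_⟩
  rintro _ ⟨y, rfl⟩
  refine (infDist_le_dist_of_mem (self_mem_convexComb hn x)).trans ?_
  have hy : ‖(y : X)‖ ≤ 1 := mem_closedBall_zero_iff.1 y.2
  exact (dist_le_norm_add_norm _ _).trans (by gcongr)

end ConvexComb

theorem uniformlyBigPoint_of_convexTransitive (𝕜 : Type*) [RCLike 𝕜] (X : Type*)
    [NormedAddCommGroup X] [NormedSpace 𝕜 X] [CompleteSpace X]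
    (hct : ConvexTransitive 𝕜 X) (x : X) (hx : x ∈ sphere (0:X) 1)
    (hbig : UniformlyBigPoint 𝕜 x) :
    ∀ y ∈ sphere (0:X) 1, UniformlyBigPoint 𝕜 y := by
  intro y hy
  refine Metric.tendsto_atTop.2 fun ε hε => ?_
  have hε3 : 0 < ε / 3 := by positivity
  obtain ⟨m, hm, hm1⟩ :=
    ((hbig.eventually (gt_mem_nhds hε3)).and (eventually_ge_atTop 1)).exists
  have hx_mem : x ∈ closure (⋃ n : ℕ, convexComb 𝕜 n y) := by
    rw [hct y hy]
    exact sphere_subset_closedBall hx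
  obtain ⟨w, hw, hxw⟩ := Metric.mem_closure_iff.1 hx_mem _ hε3
  obtain ⟨k, hk⟩ := Set.mem_iUnion.1 hw
  refine ⟨m * k, fun n hn => ?_⟩
  have hle : ⨆ z : closedBall (0:X) 1, infDist (z : X) (convexComb 𝕜 n y) ≤
      ε / 3 + ε / 3 := by
    refine Real.iSup_le (fun z => ?_) (by positivity)
    have hz : infDist (z : X) (convexComb 𝕜 m x) < ε / 3 :=
      (le_ciSup (bddAbove_range_infDist_convexComb hm1 x) z).trans_lt hm
    obtain ⟨v, hv, hzv⟩ := (infDist_lt_iff ⟨x, self_mem_convexComb hm1 x⟩).1 hz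
    obtain ⟨u, hu, hvu⟩ := exists_mem_convexComb_dist_le hn hk hv
    calc _ ≤ dist (z : X) u := infDist_le_dist_of_mem hu
      _ ≤ dist (z : X) v + dist v u := dist_triangle _ _ _
      _ ≤ ε / 3 + ε / 3 := add_le_add hzv.le (hvu.trans hxw.le)
  rw [Real.dist_0_eq_abs, abs_of_nonneg (Real.iSup_nonneg fun _ => infDist_nonneg)]
  linarith
end

section
/- Let L be a totally disconnected locally compact Hausdorff space. Then for every g in the closed unit ball of C_0^ℝ(L) and every integer k ≥ 1 there exist pairwise disjoint compact open sets C_i ⊆ L, indexed by i ∈ {1, …, 2k−1} with i ≠ k, such that the function h = Σ_{i≠k} ((i−k)/k) χ_{C_i} belongs to the closed unit ball of C_0^ℝ(L) and ‖h − g‖ ≤ 3/(2k). -/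
open Metric Filter ZeroAtInfty

/-- In a zero-dimensional locally compact Hausdorff space, a compact subset of an open set can be
separated from the complement by a clopen set. -/
theorem exists_isClopen_between {L : Type*} [TopologicalSpace L] [LocallyCompactSpace L]
    [T2Space L] [TotallyDisconnectedSpace L] {K U : Set L} (hK : IsCompact K) (hU : IsOpen U)
    (hKU : K ⊆ U) : ∃ V : Set L, IsClopen V ∧ K ⊆ V ∧ V ⊆ U := by
  refine hK.induction_on (p := fun s => ∃ V : Set L, IsClopen V ∧ s ⊆ V ∧ V ⊆ U) ?_ ?_ ?_ ?_
  · exact ⟨∅, isClopen_empty, subset_rfl, Set.empty_subset _⟩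
  · rintro s t hst ⟨V, hV, htV, hVU⟩
    exact ⟨V, hV, hst.trans htV, hVU⟩
  · rintro s t ⟨V, hV, hsV, hVU⟩ ⟨W, hW, htW, hWU⟩
    exact ⟨V ∪ W, hV.union hW, Set.union_subset_union hsV htW, Set.union_subset hVU hWU⟩
  · intro x hx
    obtain ⟨V, hV, hxV, hVU⟩ :=
      (loc_compact_Haus_tot_disc_of_zero_dim (H := L)).exists_subset_of_mem_open (hKU hx) hU
    exact ⟨V, mem_nhdsWithin_of_mem_nhds (hV.isOpen.mem_nhds hxV), V, hV, subset_rfl, hVU⟩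

theorem ZeroAtInftyContinuousMap.isCompact_setOf_le_abs {L : Type*} [TopologicalSpace L]
    (u : C₀(L, ℝ)) {a : ℝ} (ha : 0 < a) : IsCompact {t | a ≤ |u t|} := by
  have h := (zero_at_infty u).eventually (Metric.ball_mem_nhds (0 : ℝ) ha)
  obtain ⟨K, hK, hKs⟩ := Filter.mem_cocompact.1 h
  refine hK.of_isClosed_subset (isClosed_le continuous_const (map_continuous u).abs) ?_
  intro t ht
  by_contra htK
  have : dist (u t) 0 < a := hKs htK
  rw [dist_zero_right, Real.norm_eq_abs] at this
  exact this.not_ge ht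

/-- Two level sets of a function vanishing at infinity are separated by a clopen set. -/
theorem ZeroAtInftyContinuousMap.exists_isClopen_between_levels {L : Type*} [TopologicalSpace L]
    [LocallyCompactSpace L] [T2Space L] [TotallyDisconnectedSpace L] (u : C₀(L, ℝ)) {a b : ℝ}
    (hab : b < a) :
    ∃ D : Set L, IsClopen D ∧ (∀ t, a ≤ u t → t ∈ D) ∧ ∀ t ∈ D, b < u t := by
  have hu : Continuous u := map_continuous u
  rcases lt_or_ge 0 a with ha | ha
  · obtain ⟨V, hV, hKV, hVU⟩ := exists_isClopen_between
      ((u.isCompact_setOf_le_abs ha).of_isClosed_subset (isClosed_le continuous_const hu)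
        fun t (ht : a ≤ u t) => ht.trans (le_abs_self _))
      (isOpen_lt continuous_const hu) (fun t (ht : a ≤ u t) => hab.trans_le ht)
    exact ⟨V, hV, fun t ht => hKV ht, fun t ht => hVU ht⟩
  · obtain ⟨V, hV, hKV, hVU⟩ := exists_isClopen_between
      ((u.isCompact_setOf_le_abs (a := -b) (by linarith)).of_isClosed_subset
        (isClosed_le hu continuous_const)
        fun t (ht : u t ≤ b) => (neg_le_neg ht).trans (neg_le_abs _))
      (isOpen_lt hu continuous_const) (fun t (ht : u t ≤ b) => ht.trans_lt hab)
    refine ⟨Vᶜ, hV.compl, fun t ht htV => ?_, fun t ht => ?_⟩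
    · exact absurd (hVU htV : u t < a) (not_lt.2 ht)
    · by_contra h
      exact ht (hKV (not_lt.1 h))

/-- A function vanishing at infinity on a zero-dimensional space is uniformly within `3 / 4` of a
locally constant integer-valued function. -/
theorem ZeroAtInftyContinuousMap.exists_isLocallyConstant_int_near {L : Type*}
    [TopologicalSpace L] [LocallyCompactSpace L] [T2Space L] [TotallyDisconnectedSpace L]
    (u : C₀(L, ℝ)) :
    ∃ M : L → ℤ, IsLocallyConstant M ∧ ∀ t, |(M t : ℝ) - u t| < 3 / 4 := by
  choose D hD hDge hDgt using fun i : ℤ =>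
    u.exists_isClopen_between_levels (a := (i : ℝ) - 1 / 4) (b := (i : ℝ) - 3 / 4) (by linarith)
  have hex : ∀ t, ∃ i : ℤ, t ∈ D i ∧ t ∉ D (i + 1) := by
    intro t
    have h1 := Int.floor_le (u t)
    have h2 := Int.lt_floor_add_one (u t)
    by_cases h : t ∈ D (⌊u t⌋ + 1)
    · refine ⟨_, h, fun h' => ?_⟩
      have := hDgt _ t h'
      push_cast at this
      linarith
    · exact ⟨_, hDge _ t (by linarith), h⟩
  have hnear : ∀ i t, t ∈ D i → t ∉ D (i + 1) → (i : ℝ) - 3 / 4 < u t ∧ u t < i + 3 / 4 := by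
    intro i t h1 h2
    refine ⟨hDgt i t h1, ?_⟩
    by_contra h
    refine h2 (hDge _ t ?_)
    push_cast
    linarith
  choose M hM hM' using hex
  refine ⟨M, (IsLocallyConstant.iff_exists_open _).2 fun t => ?_, fun t => ?_⟩
  · refine ⟨D (M t) ∩ (D (M t + 1))ᶜ, (hD _).isOpen.inter (hD _).compl.isOpen, ⟨hM t, hM' t⟩, ?_⟩
    rintro s ⟨hs, hs'⟩
    obtain ⟨h1, h2⟩ := hnear _ s hs hs'
    obtain ⟨h3, h4⟩ := hnear _ s (hM s) (hM' s)
    have h5 : M s < M t + 2 := by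
      have : (M s : ℝ) < (M t + 2 : ℤ) := by push_cast; linarith
      exact_mod_cast this
    have h6 : M t < M s + 2 := by
      have : (M t : ℝ) < (M s + 2 : ℤ) := by push_cast; linarith
      exact_mod_cast this
    have h7 : M s ≠ M t + 1 := fun h => hs' (h ▸ hM s)
    have h8 : M t ≠ M s + 1 := fun h => hM' s (h ▸ hs)
    omega
  · obtain ⟨h1, h2⟩ := hnear _ t (hM t) (hM' t)
    rw [abs_lt]
    constructor <;> linarith

theorem technical_uct (L : Type*) [TopologicalSpace L] [LocallyCompactSpace L] [T2Space L]
    [TotallyDisconnectedSpace L]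
    (g : C₀(L, ℝ)) (hg : ‖g‖ ≤ 1) (k : ℕ) (hk : 1 ≤ k) :
    ∃ C : ℕ → Set L,
      (∀ i ∈ (Finset.Icc 1 (2*k-1)).erase k, IsCompact (C i) ∧ IsOpen (C i)) ∧
      Set.Pairwise (((Finset.Icc 1 (2*k-1)).erase k : Finset ℕ) : Set ℕ)
        (fun i j => Disjoint (C i) (C j)) ∧
      ∃ h : C₀(L, ℝ),
        (∀ t : L, h t =
          ∑ i ∈ (Finset.Icc 1 (2*k-1)).erase k,
            (((i : ℝ) - k) / k) * (C i).indicator (fun _ => (1:ℝ)) t) ∧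
        ‖h‖ ≤ 1 ∧ ‖h - g‖ ≤ 3 / (2*k) := by
  have hk0 : (0 : ℝ) < k := by exact_mod_cast hk
  have hgt : ∀ t, |g t| ≤ 1 := fun t =>
    (g.toBCF.norm_coe_le_norm t).trans hg
  obtain ⟨M, hM, hMg⟩ := ((k : ℝ) • g).exists_isLocallyConstant_int_near
  simp only [ZeroAtInftyContinuousMap.smul_apply, smul_eq_mul] at hMg
  set N : L → ℤ := fun t => max (-(k - 1 : ℤ)) (min (M t) (k - 1)) with hN
  have hNlc : IsLocallyConstant N := hM.comp fun m : ℤ => max (-(k - 1 : ℤ)) (min m (k - 1))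
  have hNle : ∀ t, -(k - 1 : ℤ) ≤ N t ∧ N t ≤ k - 1 := by
    intro t
    simp only [hN]
    omega
  have hNM : ∀ t, N t ≠ 0 → M t ≠ 0 := by
    intro t
    simp only [hN]
    omega
  have hNg : ∀ t, |(N t : ℝ) - k * g t| ≤ 1 := by
    intro t
    have h1 := abs_lt.1 (hMg t)
    have h2 := abs_le.1 (hgt t)
    have h3 : (k : ℝ) * g t ≤ k := by nlinarith
    have h4 : -(k : ℝ) ≤ k * g t := by nlinarith
    have h5 : N t = M t ∨ (N t = k - 1 ∧ N t ≤ M t) ∨ (N t = -(k - 1) ∧ M t ≤ N t) := by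
      simp only [hN]
      omega
    rw [abs_le]
    rcases h5 with h5 | ⟨h5, h6⟩ | ⟨h5, h6⟩
    · rw [h5]
      constructor <;> linarith
    · have h6' : (N t : ℝ) ≤ M t := by exact_mod_cast h6
      have h5' : (N t : ℝ) = k - 1 := by rw [h5]; push_cast; rfl
      constructor <;> linarith
    · have h6' : (M t : ℝ) ≤ N t := by exact_mod_cast h6
      have h5' : (N t : ℝ) = -(k - 1) := by rw [h5]; push_cast; rfl
      constructor <;> linarith
  have hlarge : ∀ t, N t ≠ 0 → 1 / (4 * k) ≤ |g t| := by
    intro t ht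
    have h1 : (1 : ℝ) ≤ |(M t : ℝ)| := by exact_mod_cast Int.one_le_abs (hNM t ht)
    have h2 := abs_sub_abs_le_abs_sub (M t : ℝ) (k * g t)
    rw [abs_mul, abs_of_pos hk0] at h2
    have h3 := hMg t
    rw [div_le_iff₀ (by positivity)]
    linarith
  have hbound : ∀ t, |(N t : ℝ) / k| ≤ 5 * |g t| := by
    intro t
    by_cases ht : N t = 0
    · simp [ht]
    · have h1 := hlarge t ht
      have h2 := abs_sub_abs_le_abs_sub (N t : ℝ) (k * g t)
      rw [abs_mul, abs_of_pos hk0] at h2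
      have h3 := hNg t
      rw [div_le_iff₀ (by positivity)] at h1
      rw [abs_div, abs_of_pos hk0, div_le_iff₀ hk0]
      linarith
  have hvanish : Tendsto (fun t => (N t : ℝ) / k) (cocompact L) (nhds 0) := by
    refine squeeze_zero_norm hbound ?_
    simpa using ((zero_at_infty g).abs.const_mul 5)
  have hcont : Continuous fun t => (N t : ℝ) / k :=
    (hNlc.comp fun m : ℤ => (m : ℝ) / k).continuous
  refine ⟨fun i => {t | N t = i - k}, ?_, ?_, ⟨⟨_, hcont⟩, hvanish⟩, ?_, ?_, ?_⟩
  · intro i hi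
    have hik : i ≠ k := Finset.ne_of_mem_erase hi
    refine ⟨(g.isCompact_setOf_le_abs (a := 1 / (4 * k)) (by positivity)).of_isClosed_subset
      (hNlc.isClosed_fiber _) fun t (ht : N t = i - k) => hlarge t (by omega),
      hNlc.isOpen_fiber _⟩
  · intro i _ j _ hij
    rw [Set.disjoint_left]
    intro t (hi : N t = i - k) (hj : N t = j - k)
    omega
  · intro t
    change (N t : ℝ) / k = _
    obtain ⟨h1, h2⟩ := hNle t
    by_cases ht : N t = 0
    · rw [Finset.sum_eq_zero, ht]
      · simp
      · intro i hi
        have hik : i ≠ k := Finset.ne_of_mem_erase hi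
        rw [Set.indicator_of_notMem, mul_zero]
        intro (h : N t = i - k)
        omega
    · obtain ⟨i, hi⟩ : ∃ i : ℕ, N t = i - k := ⟨(N t + k).toNat, by omega⟩
      rw [Finset.sum_eq_single i]
      · rw [Set.indicator_of_mem (by exact hi), mul_one, hi]
        push_cast
        rfl
      · intro j _ hji
        rw [Set.indicator_of_notMem, mul_zero]
        intro (h : N t = j - k)
        omega
      · intro hmem
        refine absurd (Finset.mem_erase.2 ⟨?_, Finset.mem_Icc.2 ⟨?_, ?_⟩⟩) hmem <;> omega
  · refine (BoundedContinuousFunction.norm_le zero_le_one).2 fun t => ?_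
    change |(N t : ℝ) / k| ≤ 1
    rw [abs_div, abs_of_pos hk0, div_le_one hk0, abs_le]
    obtain ⟨h1, h2⟩ := hNle t
    have h1' : -(k - 1 : ℝ) ≤ N t := by exact_mod_cast h1
    have h2' : (N t : ℝ) ≤ k - 1 := by exact_mod_cast h2
    constructor <;> linarith
  · refine (BoundedContinuousFunction.norm_le (by positivity)).2 fun t => ?_
    change |(N t : ℝ) / k - g t| ≤ 3 / (2 * k)
    have h : (N t : ℝ) / k - g t = (N t - k * g t) / k := by field_simp
    rw [h, abs_div, abs_of_pos hk0, div_le_div_iff₀ hk0 (by positivity)]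
    nlinarith [hNg t]
end

section
/- Let L be a locally compact Hausdorff space with more than one point and 𝕂 ∈ {ℝ, ℂ}. If the Banach space C_0^𝕂(L) is convex-transitive, then L contains no isolated points. -/
open Metric Filter ZeroAtInfty

/-- Urysohn's lemma with values in `C₀(L, 𝕜)`. -/
theorem exists_zeroAtInfty_one_zero_of_isCompact (𝕜 : Type*) [RCLike 𝕜]
    {L : Type*} [TopologicalSpace L] [LocallyCompactSpace L] [T2Space L] {K F : Set L}
    (hK : IsCompact K) (hF : IsClosed F) (hKF : Disjoint K F) :
    ∃ f : C₀(L, 𝕜), (∀ x ∈ K, f x = 1) ∧ (∀ x ∈ F, f x = 0) ∧ ∀ x, ‖f x‖ ≤ 1 := by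
  obtain ⟨f, hf1, hf0, hfc, hf⟩ := exists_continuous_one_zero_of_isCompact hK hF hKF
  have hc : HasCompactSupport (fun x => ((f x : ℝ) : 𝕜)) :=
    hfc.comp_left (g := fun r : ℝ => (r : 𝕜)) RCLike.ofReal_zero
  refine ⟨⟨⟨fun x => (f x : 𝕜), by fun_prop⟩, hc.is_zero_at_infty⟩, fun x hx => ?_,
    fun x hx => ?_, fun x => ?_⟩
  · change ((f x : ℝ) : 𝕜) = 1
    simp [hf1 hx]
  · change ((f x : ℝ) : 𝕜) = 0
    simp [hf0 hx]
  · change ‖((f x : ℝ) : 𝕜)‖ ≤ 1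
    rw [RCLike.norm_ofReal, abs_of_nonneg (hf x).1]
    exact (hf x).2

theorem ZeroAtInftyContinuousMap.norm_le_one {𝕜 : Type*} [RCLike 𝕜]
    {L : Type*} [TopologicalSpace L] {f : C₀(L, 𝕜)} (hf : ∀ x, ‖f x‖ ≤ 1) : ‖f‖ ≤ 1 := by
  rw [← ZeroAtInftyContinuousMap.norm_toBCF_eq_norm]
  exact (BoundedContinuousFunction.norm_le zero_le_one).2 hf

theorem ZeroAtInftyContinuousMap.norm_apply_le {𝕜 : Type*} [RCLike 𝕜]
    {L : Type*} [TopologicalSpace L] (f : C₀(L, 𝕜)) (x : L) : ‖f x‖ ≤ ‖f‖ := by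
  rw [← ZeroAtInftyContinuousMap.norm_toBCF_eq_norm]
  exact f.toBCF.norm_coe_le_norm x

theorem RCLike.exists_norm_eq_one_norm_add_mul (𝕜 : Type*) [RCLike 𝕜] (a b : 𝕜) :
    ∃ c : 𝕜, ‖c‖ = 1 ∧ ‖a + c * b‖ = ‖a‖ + ‖b‖ := by
  rcases eq_or_ne a 0 with rfl | ha
  · exact ⟨1, by simp⟩
  rcases eq_or_ne b 0 with rfl | hb
  · exact ⟨1, by simp⟩
  have ha' : ‖a‖ ≠ 0 := norm_ne_zero_iff.2 ha
  have hb' : ‖b‖ ≠ 0 := norm_ne_zero_iff.2 hb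
  have ha2 : (‖a‖ : 𝕜) ≠ 0 := RCLike.ofReal_ne_zero.2 ha'
  refine ⟨a / b * (‖b‖ / ‖a‖ : ℝ), ?_, ?_⟩
  · rw [norm_mul, norm_div, RCLike.norm_ofReal, abs_of_nonneg (by positivity)]
    field_simp
  · have : a + a / b * ((‖b‖ / ‖a‖ : ℝ) : 𝕜) * b = a * (((‖a‖ + ‖b‖) / ‖a‖ : ℝ) : 𝕜) := by
      push_cast
      field_simp
    rw [this, norm_mul, RCLike.norm_ofReal, abs_of_nonneg (by positivity)]
    field_simp

section IndicatorOfIsolatedPoint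

variable {𝕜 : Type*} [RCLike 𝕜] {L : Type*} [TopologicalSpace L] {t : L} {e : C₀(L, 𝕜)}

/-- If `e` is the indicator of `{t}` and `T` is a rotation with `T e p ≠ 0`, then the functional
`x ↦ (T⁻¹ x) t` has norm at least one on norm-one functions peaking at `p`. -/
theorem one_le_norm_symm_apply (het : e t = 1) (he : ∀ q, q ≠ t → e q = 0)
    (T : C₀(L, 𝕜) ≃ₗᵢ[𝕜] C₀(L, 𝕜)) {p : L} (hp : T e p ≠ 0) {x : C₀(L, 𝕜)}
    (hx : ‖x‖ ≤ 1) (hxp : x p = 1) : 1 ≤ ‖T.symm x t‖ := by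
  set a : 𝕜 := T.symm x t with ha
  obtain ⟨c, hc, hcn⟩ :=
    RCLike.exists_norm_eq_one_norm_add_mul 𝕜 (x p - a * T e p) (T e p)
  have hle : ‖T.symm x + (c - a) • e‖ ≤ 1 := by
    refine ZeroAtInftyContinuousMap.norm_le_one fun q => ?_
    rcases eq_or_ne q t with rfl | hq
    · simp [het, ← ha, hc]
    · simpa [he q hq] using (T.symm x).norm_apply_le q |>.trans (by simpa using hx)
  have hTle : ‖x + (c - a) • T e‖ ≤ 1 := by
    rw [← T.norm_map] at hle
    simpa only [map_add, map_smul, T.apply_symm_apply] using hle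
  have h1 : ‖x p - a * T e p‖ + ‖T e p‖ ≤ 1 := by
    rw [← hcn]
    refine le_trans (le_of_eq ?_) (((x + (c - a) • T e).norm_apply_le p).trans hTle)
    congr 1
    simp only [ZeroAtInftyContinuousMap.coe_add, ZeroAtInftyContinuousMap.coe_smul,
      Pi.add_apply, Pi.smul_apply, smul_eq_mul]
    ring
  have h2 : 1 ≤ ‖x p - a * T e p‖ + ‖a‖ * ‖T e p‖ := by
    calc (1 : ℝ) = ‖(x p - a * T e p) + a * T e p‖ := by simp [hxp]
      _ ≤ _ := (norm_add_le _ _).trans_eq (by rw [norm_mul])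
  have hpos : 0 < ‖T e p‖ := norm_pos_iff.2 hp
  exact le_of_mul_le_mul_right (by linarith) hpos

/-- A rotation of the indicator of an isolated point cannot be nonzero at both `t` and `s`. -/
theorem norm_apply_add_norm_apply_le_one (het : e t = 1) (he : ∀ q, q ≠ t → e q = 0)
    {s : L} (hst : s ≠ t) {g : C₀(L, 𝕜)} (hgs : g s = 1) (hgt : g t = 0)
    (hg : ∀ q, ‖g q‖ ≤ 1) (T : C₀(L, 𝕜) ≃ₗᵢ[𝕜] C₀(L, 𝕜)) :
    ‖T e t‖ + ‖T e s‖ ≤ 1 := by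
  have hnorm (c : 𝕜) (hc : ‖c‖ = 1) : ‖e + c • g‖ ≤ 1 := by
    refine ZeroAtInftyContinuousMap.norm_le_one fun q => ?_
    rcases eq_or_ne q t with rfl | hq
    · simp [het, hgt]
    · simpa [he q hq, hc] using hg q
  have hen : ‖e‖ ≤ 1 := by
    refine ZeroAtInftyContinuousMap.norm_le_one fun q => ?_
    rcases eq_or_ne q t with rfl | hq
    · simp [het]
    · simp [he q hq]
  have hTe (q : L) : ‖T e q‖ ≤ 1 := ((T e).norm_apply_le q).trans (by simpa using hen)
  by_cases ht : T e t = 0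
  · simpa [ht] using hTe s
  by_cases hs : T e s = 0
  · simpa [hs] using hTe t
  have h1 := one_le_norm_symm_apply het he T ht hen het
  have h2 := one_le_norm_symm_apply het he T hs (ZeroAtInftyContinuousMap.norm_le_one hg) hgs
  obtain ⟨c, hc, hcn⟩ :=
    RCLike.exists_norm_eq_one_norm_add_mul 𝕜 (T.symm e t) (T.symm g t)
  have h3 : ‖T.symm (e + c • g) t‖ ≤ 1 :=
    ((T.symm (e + c • g)).norm_apply_le t).trans ((T.symm.norm_map _).trans_le (hnorm c hc))
  rw [map_add, map_smul] at h3
  simp only [ZeroAtInftyContinuousMap.coe_add, ZeroAtInftyContinuousMap.coe_smul,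
    Pi.add_apply, Pi.smul_apply, smul_eq_mul, hcn] at h3
  linarith

end IndicatorOfIsolatedPoint

/-- A continuous seminorm bounded by one on the orbit of `x` is bounded by one on its closed
convex hull. -/
theorem seminorm_le_one_of_mem_closure_convexComb {𝕜 : Type*} [RCLike 𝕜] {X : Type*}
    [NormedAddCommGroup X] [NormedSpace 𝕜 X] (N : Seminorm 𝕜 X) (hN : Continuous N) {x z : X}
    (hx : ∀ T : X ≃ₗᵢ[𝕜] X, N (T x) ≤ 1) (hz : z ∈ closure (⋃ n : ℕ, convexComb 𝕜 n x)) :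
    N z ≤ 1 := by
  refine closure_minimal (t := {z | N z ≤ 1}) ?_ (isClosed_le hN continuous_const) hz
  refine Set.iUnion_subset fun n => ?_
  rintro _ ⟨T, a, ha, hsum, rfl⟩
  calc N (∑ i, ((a i : 𝕜) • T i x)) ≤ ∑ i, N ((a i : 𝕜) • T i x) :=
        Finset.le_sum_of_subadditive N (map_zero N).le (map_add_le_add N) _ _
    _ ≤ ∑ i, a i := Finset.sum_le_sum fun i _ => by
        rw [map_smul_eq_mul, RCLike.norm_ofReal, abs_of_nonneg (ha i).1]
        exact mul_le_of_le_one_right (ha i).1 (hx _)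
    _ = 1 := hsum

/-- Evaluation at a point as a linear functional on `C₀(L, 𝕜)`. -/
def ZeroAtInftyContinuousMap.evalLinearMap (𝕜 : Type*) [RCLike 𝕜] {L : Type*}
    [TopologicalSpace L] (x : L) : C₀(L, 𝕜) →ₗ[𝕜] 𝕜 where
  toFun f := f x
  map_add' _ _ := rfl
  map_smul' _ _ := rfl

theorem ZeroAtInftyContinuousMap.continuous_evalLinearMap (𝕜 : Type*) [RCLike 𝕜] {L : Type*}
    [TopologicalSpace L] (x : L) :
    Continuous (ZeroAtInftyContinuousMap.evalLinearMap 𝕜 x) :=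
  AddMonoidHomClass.continuous_of_bound _ 1 fun f =>
    (f.norm_apply_le x).trans_eq (one_mul _).symm

theorem no_isolated_points_of_C0_convexTransitive (𝕜 : Type*) [RCLike 𝕜]
    (L : Type*) [TopologicalSpace L] [LocallyCompactSpace L] [T2Space L] [Nontrivial L]
    (h : ConvexTransitive 𝕜 C₀(L, 𝕜)) : ∀ t : L, ¬ IsOpen ({t} : Set L) := by
  intro t ht
  obtain ⟨s, hst⟩ := exists_ne t
  obtain ⟨e, he1, he0, he⟩ := exists_zeroAtInfty_one_zero_of_isCompact 𝕜
    (isCompact_singleton (x := t)) ht.isClosed_compl disjoint_compl_right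
  obtain ⟨g, hg1, hg0, hg⟩ := exists_zeroAtInfty_one_zero_of_isCompact 𝕜
    (isCompact_singleton (x := s)) (isClosed_singleton (x := t))
    (Set.disjoint_singleton.2 hst)
  have het : e t = 1 := he1 t rfl
  have hgs : g s = 1 := hg1 s rfl
  have hgt : g t = 0 := hg0 t rfl
  have he0' : ∀ q, q ≠ t → e q = 0 := fun q hq => he0 q hq
  have hen : ‖e‖ = 1 := le_antisymm (ZeroAtInftyContinuousMap.norm_le_one he)
    (by simpa [het] using e.norm_apply_le t)
  have hmem : e + g ∈ closure (⋃ n : ℕ, convexComb 𝕜 n e) := by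
    rw [h e (by simpa using hen), mem_closedBall_zero_iff]
    refine ZeroAtInftyContinuousMap.norm_le_one fun q => ?_
    rcases eq_or_ne q t with rfl | hq
    · simp [het, hgt]
    · simpa [he0' q hq] using hg q
  have hev (x : L) := ZeroAtInftyContinuousMap.continuous_evalLinearMap 𝕜 x
  have key := seminorm_le_one_of_mem_closure_convexComb
    ((normSeminorm 𝕜 𝕜).comp (ZeroAtInftyContinuousMap.evalLinearMap 𝕜 t) +
      (normSeminorm 𝕜 𝕜).comp (ZeroAtInftyContinuousMap.evalLinearMap 𝕜 s))
    ((hev t).norm.add (hev s).norm)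
    (fun T => norm_apply_add_norm_apply_le_one het he0' hst hgs hgt hg T) hmem
  change ‖(e + g) t‖ + ‖(e + g) s‖ ≤ 1 at key
  norm_num [het, hgt, hgs, he0' s hst] at key
end

section
/- Let n ∈ ℕ and let L_1, …, L_n be totally disconnected locally compact Hausdorff spaces each satisfying condition (*). Then the product space L_1 × ⋯ × L_n is a totally disconnected locally compact Hausdorff space satisfying condition (*). -/
open Metric Filter

/-- Condition (*): for each `ε > 0` there is `M ∈ ℕ` such that for every non-empty open
`U ⊆ L` and compact `K ⊆ L` there are homeomorphisms `φ₁, …, φ_M : L → L` with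
`(1/M) ∑ᵢ χ_{φᵢ⁻¹(U)}(t) ≥ 1 - ε` for all `t ∈ K`. -/
def StarCondition (L : Type*) [TopologicalSpace L] : Prop :=
  ∀ ε : ℝ, 0 < ε → ∃ M : ℕ, ∀ U : Set L, IsOpen U → U.Nonempty →
    ∀ K : Set L, IsCompact K → ∃ φ : Fin M → (L ≃ₜ L), ∀ t ∈ K,
      1 - ε ≤ (M : ℝ)⁻¹ * ∑ i, ((φ i) ⁻¹' U).indicator (fun _ => (1:ℝ)) t

/-- The product homeomorphisms `∏ᵢ φᵢ,ⱼ₍ᵢ₎`, indexed by all choices `j`, average the indicator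
function of a box to the product of the averages of the factors. -/
theorem StarCondition.pi {ι : Type*} [Fintype ι] {L : ι → Type*} [∀ i, TopologicalSpace (L i)]
    (h : ∀ i, StarCondition (L i)) : StarCondition (∀ i, L i) := by
  classical
  intro ε hε
  set n : ℝ := (Fintype.card ι : ℝ)
  have hn0 : 0 ≤ n := Nat.cast_nonneg _
  set δ : ℝ := min ε 1 / (n + 1) with hδ
  have hδ0 : 0 < δ := by positivity
  have hδn : (n + 1) * δ = min ε 1 := by rw [hδ]; field_simp
  have hδ1 : δ ≤ 1 := by nlinarith [min_le_right ε 1, mul_nonneg hn0 hδ0.le]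
  have hδε : n * δ ≤ ε := by nlinarith [min_le_left ε 1]
  choose M hM using fun i => h i δ hδ0
  refine ⟨Fintype.card (∀ i, Fin (M i)), fun U hU ⟨x, hx⟩ K hK => ?_⟩
  obtain ⟨V, hV, hVU⟩ := isOpen_pi_iff'.1 hU x hx
  choose φ hφ using fun i => hM i (V i) (hV i).1 ⟨x i, (hV i).2⟩ (Function.eval i '' K)
    (hK.image (continuous_apply i))
  let e := Fintype.equivFin (∀ i, Fin (M i))
  refine ⟨fun k => Homeomorph.piCongrRight fun i => φ i (e.symm k i), fun t ht => ?_⟩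
  rw [e.symm.sum_comp fun j : ∀ i, Fin (M i) =>
    ((Homeomorph.piCongrRight fun i => φ i (j i)) ⁻¹' U).indicator (fun _ => (1 : ℝ)) t]
  have hbox (j : ∀ i, Fin (M i)) :
      ∏ i, ((φ i (j i)) ⁻¹' V i).indicator (fun _ => (1 : ℝ)) (t i) ≤
        ((Homeomorph.piCongrRight fun i => φ i (j i)) ⁻¹' U).indicator (fun _ => (1 : ℝ)) t := by
    by_cases hj : ∀ i, φ i (j i) (t i) ∈ V i
    · rw [Set.indicator_of_mem
        (show t ∈ (Homeomorph.piCongrRight fun i => φ i (j i)) ⁻¹' U from hVU fun i _ => hj i)]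
      exact Finset.prod_le_one (fun i _ => Set.indicator_nonneg (fun _ _ => zero_le_one) _)
        fun i _ => Set.indicator_le_self' (fun _ _ => zero_le_one) _
    · push Not at hj
      obtain ⟨i, hi⟩ := hj
      rw [Finset.prod_eq_zero (Finset.mem_univ i)
        (Set.indicator_of_notMem (show t i ∉ (φ i (j i)) ⁻¹' V i from hi) _)]
      exact Set.indicator_nonneg (fun _ _ => zero_le_one) _
  calc 1 - ε ≤ 1 + n * (-δ) := by linarith
    _ ≤ (1 + -δ) ^ Fintype.card ι := one_add_mul_le_pow (by linarith) _
    _ = ∏ _i : ι, (1 - δ) := by simp [sub_eq_add_neg]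
    _ ≤ ∏ i, ((M i : ℝ)⁻¹ *
          ∑ k, ((φ i k) ⁻¹' V i).indicator (fun _ => (1 : ℝ)) (t i)) :=
      Finset.prod_le_prod (fun _ _ => by linarith) fun i _ => hφ i (t i) ⟨t, ht, rfl⟩
    _ = (Fintype.card (∀ i, Fin (M i)) : ℝ)⁻¹ *
          ∑ j : ∀ i, Fin (M i),
            ∏ i, ((φ i (j i)) ⁻¹' V i).indicator (fun _ => (1 : ℝ)) (t i) := by
      rw [Finset.prod_mul_distrib, Fintype.prod_sum]
      simp [Fintype.card_pi]
    _ ≤ _ := by gcongr with j; exact hbox j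

theorem starCondition_pi (n : ℕ) (L : Fin n → Type*) [∀ i, TopologicalSpace (L i)]
    [∀ i, LocallyCompactSpace (L i)] [∀ i, T2Space (L i)]
    [∀ i, TotallyDisconnectedSpace (L i)] (hstar : ∀ i, StarCondition (L i)) :
    TotallyDisconnectedSpace (∀ i, L i) ∧ LocallyCompactSpace (∀ i, L i) ∧
      T2Space (∀ i, L i) ∧ StarCondition (∀ i, L i) :=
  ⟨inferInstance, inferInstance, inferInstance, .pi hstar⟩
end

section
/- Let L be a locally compact Hausdorff space such that the real Banach space C_0^ℝ(L) is convex-transitive, and let X be a convex-transitive Banach space over 𝕂 ∈ {ℝ, ℂ}. Then the Banach space C_0^𝕂(L, X) is convex-transitive. -/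
open Metric Filter ZeroAtInfty

section ConvexTransitivity

open Set Topology

namespace ZeroAtInftyContinuousMap

variable {L : Type*} [TopologicalSpace L] {E : Type*} [NormedAddCommGroup E]

theorem norm_le_iff_forall {f : C₀(L, E)} {C : ℝ} (hC : 0 ≤ C) :
    ‖f‖ ≤ C ↔ ∀ t, ‖f t‖ ≤ C := by
  rw [← norm_toBCF_eq_norm, BoundedContinuousFunction.norm_le hC]
  rfl

theorem norm_apply_le_norm (f : C₀(L, E)) (t : L) : ‖f t‖ ≤ ‖f‖ :=
  (norm_le_iff_forall (norm_nonneg f)).1 le_rfl t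

theorem isCompact_le_norm (f : C₀(L, E)) {c : ℝ} (hc : 0 < c) :
    IsCompact {t | c ≤ ‖f t‖} := by
  have hcl : IsClosed {t | c ≤ ‖f t‖} :=
    isClosed_le continuous_const (map_continuous f).norm
  have h : ∀ᶠ t in cocompact L, ‖f t‖ < c := by
    have := (zero_at_infty f).norm
    rw [norm_zero] at this
    exact this.eventually (gt_mem_nhds hc)
  obtain ⟨K, hK, hKs⟩ := mem_cocompact.1 h
  refine hK.of_isClosed_subset hcl fun t ht => ?_
  by_contra hn
  exact not_le.2 (show ‖f t‖ < c from hKs hn) ht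

theorem exists_norm_apply_eq_norm (f : C₀(L, E)) (hf : f ≠ 0) : ∃ t, ‖f t‖ = ‖f‖ := by
  obtain ⟨t₀, ht₀⟩ : ∃ t, f t ≠ 0 := by
    by_contra! h
    exact hf (ext h)
  have h : ∀ᶠ t in cocompact L, ‖f t‖ ≤ ‖f t₀‖ := by
    have := (zero_at_infty f).norm
    rw [norm_zero] at this
    exact (this.eventually (gt_mem_nhds (norm_pos_iff.2 ht₀))).mono fun _ h => h.le
  obtain ⟨t, ht⟩ := (map_continuous f).norm.exists_forall_ge' t₀ h
  exact ⟨t, le_antisymm (norm_apply_le_norm f t) ((norm_le_iff_forall (norm_nonneg _)).2 ht)⟩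

theorem finsetSum_apply {ι : Type*} (s : Finset ι) (f : ι → C₀(L, E)) (t : L) :
    (∑ i ∈ s, f i) t = ∑ i ∈ s, f i t := by
  classical
  induction s using Finset.induction_on with
  | empty => rfl
  | insert i s hi ih => simp [Finset.sum_insert hi, ih]

section Real

variable [LocallyCompactSpace L] [T2Space L]

theorem exists_bump {Q U : Set L} (hQ : IsCompact Q) (hU : IsOpen U) (hQU : Q ⊆ U) :
    ∃ e : C₀(L, ℝ), (∀ t ∈ Q, e t = 1) ∧ (∀ t ∉ U, e t = 0) ∧ ∀ t, 0 ≤ e t ∧ e t ≤ 1 := by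
  obtain ⟨e, h1, h0, hc, h01⟩ := exists_continuous_one_zero_of_isCompact hQ hU.isClosed_compl
    (disjoint_compl_right_iff_subset.2 hQU)
  exact ⟨⟨e, hc.is_zero_at_infty⟩, h1, h0, h01⟩

/-- The pointwise form of the Banach–Stone theorem. -/
theorem exists_weighted_eval (U : C₀(L, ℝ) ≃ₗᵢ[ℝ] C₀(L, ℝ)) (t' : L) :
    ∃ (t : L) (s : ℝ), (s = 1 ∨ s = -1) ∧ ∀ g, U g t = s * g t' := by
  obtain ⟨u, hu1, -, hu⟩ := exists_bump (isCompact_singleton (x := t')) isOpen_univ (subset_univ _)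
  replace hu1 : u t' = 1 := hu1 t' rfl
  have hun : ‖u‖ ≤ 1 := (norm_le_iff_forall zero_le_one).2 fun x => by
    rw [Real.norm_eq_abs, abs_le]
    constructor <;> linarith [hu x]
  let ι := {g : C₀(L, ℝ) // ‖g‖ ≤ 1 ∧ g t' = 1}
  have : Nonempty ι := ⟨⟨u, hun, hu1⟩⟩
  let M : ι → Set (L × ℝ) := fun g => {p | (p.2 = 1 ∨ p.2 = -1) ∧ p.2 * U g.1 p.1 = 1}
  have hMcl : ∀ g, IsClosed (M g) := fun g => by
    refine IsClosed.inter ?_ ?_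
    · exact (isClosed_eq continuous_snd continuous_const).union
        (isClosed_eq continuous_snd continuous_const)
    · exact isClosed_eq (continuous_snd.mul ((map_continuous (U g.1)).comp continuous_fst))
        continuous_const
  have hMc : ∀ g, IsCompact (M g) := fun g => by
    refine ((isCompact_le_norm (U g.1) one_pos).prod
      (s := _) (t := ({1, -1} : Set ℝ)) (toFinite _).isCompact).of_isClosed_subset (hMcl g) ?_
    rintro ⟨a, s⟩ ⟨hs, h⟩
    refine ⟨?_, by simpa using hs⟩
    simp only at hs h
    simp only [mem_ofPred_eq, Real.norm_eq_abs]
    rcases hs with rfl | rfl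
    · exact le_abs.2 (Or.inl (by linarith))
    · exact le_abs.2 (Or.inr (by linarith))
  have hMn : ∀ g, (M g).Nonempty := fun g => by
    have hn : ‖U g.1‖ = 1 := by
      rw [U.norm_map]
      refine le_antisymm g.2.1 ?_
      have := norm_apply_le_norm g.1 t'
      rwa [g.2.2, norm_one] at this
    obtain ⟨t, ht⟩ := exists_norm_apply_eq_norm (U g.1) (by
      rw [← norm_ne_zero_iff, hn]; exact one_ne_zero)
    rw [hn, Real.norm_eq_abs] at ht
    rcases eq_or_eq_neg_of_abs_eq ht with h | h
    · exact ⟨(t, 1), Or.inl rfl, by simp [h]⟩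
    · exact ⟨(t, -1), Or.inr rfl, by simp [h]⟩
  have hbd : ∀ (g : ι) (p : L × ℝ), (p.2 = 1 ∨ p.2 = -1) → p.2 * U g.1 p.1 ≤ 1 := by
    rintro g ⟨a, s⟩ hs
    have h := (norm_apply_le_norm (U g.1) a).trans ((U.norm_map g.1).le.trans g.2.1)
    rw [Real.norm_eq_abs, abs_le] at h
    simp only at hs ⊢
    rcases hs with rfl | rfl <;> linarith
  have hMd : Directed (· ⊇ ·) M := by
    intro g h
    have hmid : ‖(1 / 2 : ℝ) • (g.1 + h.1)‖ ≤ 1 ∧ ((1 / 2 : ℝ) • (g.1 + h.1)) t' = 1 := by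
      constructor
      · rw [norm_smul]
        have := norm_add_le g.1 h.1
        norm_num
        linarith [g.2.1, h.2.1]
      · simp [g.2.2, h.2.2]
        norm_num
    have key : ∀ p ∈ M ⟨_, hmid⟩, p ∈ M g ∧ p ∈ M h := by
      rintro p ⟨hs, hp⟩
      simp only [map_smul, map_add, smul_apply, add_apply, smul_eq_mul] at hp
      have h1 := hbd g p hs
      have h2 := hbd h p hs
      exact ⟨⟨hs, by linarith⟩, ⟨hs, by linarith⟩⟩
    exact ⟨⟨_, hmid⟩, fun p hp => (key p hp).1, fun p hp => (key p hp).2⟩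
  obtain ⟨⟨t, s⟩, hts⟩ :=
    IsCompact.nonempty_iInter_of_directed_nonempty_isCompact_isClosed M hMd hMn hMc hMcl
  rw [mem_iInter] at hts
  have hs : s = 1 ∨ s = -1 := (hts ⟨u, hun, hu1⟩).1
  have hss : s * s = 1 := by rcases hs with rfl | rfl <;> norm_num
  have hU : ∀ g : C₀(L, ℝ), ‖g‖ ≤ 1 → g t' = 1 → U g t = s := fun g h1 h2 => by
    have h := (hts ⟨g, h1, h2⟩).2
    simp only at h
    calc U g t = s * s * U g t := by rw [hss, one_mul]
      _ = s := by rw [mul_assoc, h, mul_one]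
  have hball : ∀ g : C₀(L, ℝ), ‖g‖ ≤ 1 → g t' = 0 → U g t = 0 := fun g hg h0 => by
    let e : C₀(L, ℝ) := ⟨⟨fun x => u x * (1 - |g x|), by fun_prop⟩, by
      have := (zero_at_infty u).mul
        ((tendsto_const_nhds (x := (1 : ℝ))).sub (zero_at_infty g).abs)
      simpa using this⟩
    have he : ∀ x, e x = u x * (1 - |g x|) := fun _ => rfl
    have hle : ∀ x, |e x| + |g x| ≤ 1 := fun x => by
      have h1 : |g x| ≤ 1 := (norm_apply_le_norm g x).trans hg
      rw [he, abs_of_nonneg (mul_nonneg (hu x).1 (by linarith))]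
      nlinarith [hu x]
    have hp := hU (e + g) ((norm_le_iff_forall zero_le_one).2 fun x =>
      (abs_add_le _ _).trans (hle x)) (by simp [he, h0, hu1])
    have hm := hU (e - g) ((norm_le_iff_forall zero_le_one).2 fun x =>
      (abs_sub _ _).trans (hle x)) (by simp [he, h0, hu1])
    simp only [map_add, map_sub, add_apply, sub_apply] at hp hm
    linarith
  have hker : ∀ g : C₀(L, ℝ), g t' = 0 → U g t = 0 := fun g h0 => by
    have hpos : 0 < ‖g‖ + 1 := by positivity
    have h := hball ((‖g‖ + 1)⁻¹ • g) (by
      rw [norm_smul, norm_inv, Real.norm_of_nonneg hpos.le, inv_mul_le_one₀ hpos]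
      linarith) (by simp [h0])
    simpa [hpos.ne'] using h
  refine ⟨t, s, hs, fun g => ?_⟩
  have h := hker (g - g t' • u) (by simp [hu1])
  simp only [map_sub, map_smul, sub_apply, smul_apply, smul_eq_mul, hU u hun hu1] at h
  linarith

theorem eq_of_forall_abs_apply_eq {a b : L} (h : ∀ f : C₀(L, ℝ), |f a| = |f b|) : a = b := by
  by_contra hab
  obtain ⟨e, h1, h0, -⟩ := exists_bump (isCompact_singleton (x := a))
    (isOpen_compl_singleton (x := b)) (singleton_subset_iff.2 hab)
  have := h e
  rw [h1 a rfl, h0 b (by simp)] at this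
  simp at this

/-- The Banach–Stone theorem for surjective linear isometries of `C₀(L, ℝ)`. -/
theorem exists_homeomorph_of_isometry (T : C₀(L, ℝ) ≃ₗᵢ[ℝ] C₀(L, ℝ)) :
    ∃ (φ : L ≃ₜ L) (σ : L → ℝ), (∀ t, σ t = 1 ∨ σ t = -1) ∧ ∀ f t, T f t = σ t * f (φ t) := by
  have key : ∀ T : C₀(L, ℝ) ≃ₗᵢ[ℝ] C₀(L, ℝ), ∃ (φ : L → L) (σ : L → ℝ),
      (∀ t, σ t = 1 ∨ σ t = -1) ∧ (∀ f t, T f t = σ t * f (φ t)) ∧ Continuous φ := by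
    intro T
    choose φ σ hσ h using exists_weighted_eval T.symm
    have hT : ∀ f t, T f t = σ t * f (φ t) := fun f t => by
      have := h t (T f)
      rw [T.symm_apply_apply] at this
      rw [this, ← mul_assoc]
      rcases hσ t with h | h <;> simp [h]
    refine ⟨φ, σ, hσ, hT, continuous_iff_continuousAt.2 fun t => ?_⟩
    intro V hV
    obtain ⟨W, hWV, hW, htW⟩ := mem_nhds_iff.1 hV
    obtain ⟨e, h1, h0, -⟩ := exists_bump (isCompact_singleton (x := φ t)) hW (by simpa using htW)
    have hne : T e t ≠ 0 := by
      rw [hT, h1 _ rfl]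
      rcases hσ t with h | h <;> simp [h]
    refine mem_map.2 (((map_continuous (T e)).continuousAt.eventually_ne hne).mono fun x hx => ?_)
    refine hWV ?_
    by_contra hn
    exact hx (by rw [hT, h0 _ hn, mul_zero])
  obtain ⟨φ, σ, hσ, hT, hφ⟩ := key T
  obtain ⟨ψ, τ, hτ, hS, hψ⟩ := key T.symm
  have habs : ∀ {r : ℝ}, r = 1 ∨ r = -1 → |r| = 1 := by
    rintro r (rfl | rfl) <;> simp
  refine ⟨⟨⟨φ, ψ, fun t => ?_, fun t => ?_⟩, hφ, hψ⟩, σ, hσ, hT⟩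
  · refine eq_of_forall_abs_apply_eq fun f => ?_
    have := hT (T.symm f) t
    rw [T.apply_symm_apply, hS] at this
    rw [this, abs_mul, abs_mul, habs (hσ _), habs (hτ _), one_mul, one_mul]
  · refine eq_of_forall_abs_apply_eq fun f => ?_
    have := hS (T f) t
    rw [T.symm_apply_apply, hT] at this
    rw [this, abs_mul, abs_mul, habs (hσ _), habs (hτ _), one_mul, one_mul]

end Real

end ZeroAtInftyContinuousMap

section Hull

variable {𝕜 : Type*} [RCLike 𝕜] {E : Type*} [NormedAddCommGroup E] [NormedSpace 𝕜 E]

theorem iUnion_convexComb_eq_convexHull [NormedSpace ℝ E] [IsScalarTower ℝ 𝕜 E] (x : E) :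
    ⋃ n : ℕ, convexComb 𝕜 n x = convexHull ℝ (range fun T : E ≃ₗᵢ[𝕜] E => T x) := by
  ext z
  rw [mem_iUnion, mem_convexHull_iff_exists_fintype]
  constructor
  · rintro ⟨n, T, a, ha, ha1, rfl⟩
    refine ⟨Fin n, inferInstance, a, fun i => T i x, fun i => (ha i).1, ha1,
      fun i => mem_range_self _, ?_⟩
    simp only [RCLike.real_smul_eq_coe_smul (K := 𝕜)]
  · rintro ⟨ι, _, a, z, ha, ha1, hz, rfl⟩
    choose T hT using hz
    let e := Fintype.equivFin ι
    refine ⟨Fintype.card ι, fun i => T (e.symm i), fun i => a (e.symm i),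
      fun i => ⟨ha _, ?_⟩, ?_, ?_⟩
    · rw [← ha1]
      exact Finset.single_le_sum (fun j _ => ha j) (Finset.mem_univ _)
    · rw [e.symm.sum_comp a, ha1]
    · rw [e.symm.sum_comp (fun j => ((a j : 𝕜) • T j x))]
      exact Finset.sum_congr rfl fun i _ => by
        rw [RCLike.real_smul_eq_coe_smul (K := 𝕜), ← hT i]

theorem map_mem_closure_iUnion_convexComb (T : E ≃ₗᵢ[𝕜] E) {x z : E}
    (hz : z ∈ closure (⋃ n : ℕ, convexComb 𝕜 n x)) :
    T z ∈ closure (⋃ n : ℕ, convexComb 𝕜 n x) := by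
  refine map_mem_closure T.continuous hz fun y hy => ?_
  obtain ⟨n, S, a, ha, ha1, rfl⟩ := mem_iUnion.1 hy
  exact mem_iUnion.2 ⟨n, fun i => (S i).trans T, a, ha, ha1, by simp⟩

theorem self_mem_closure_iUnion_convexComb (x : E) :
    x ∈ closure (⋃ n : ℕ, convexComb 𝕜 n x) :=
  subset_closure <| mem_iUnion.2
    ⟨1, fun _ => LinearIsometryEquiv.refl 𝕜 E, fun _ => 1, by simp, by simp, by simp⟩

theorem closure_iUnion_convexComb_subset_closedBall {x : E} (hx : ‖x‖ ≤ 1) :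
    closure (⋃ n : ℕ, convexComb 𝕜 n x) ⊆ closedBall (0 : E) 1 := by
  refine closure_minimal (iUnion_subset fun n => ?_) isClosed_closedBall
  rintro z ⟨T, a, ha, ha1, rfl⟩
  rw [mem_closedBall_zero_iff, ← ha1]
  refine (norm_sum_le _ _).trans (Finset.sum_le_sum fun i _ => ?_)
  rw [norm_smul, RCLike.norm_ofReal, abs_of_nonneg (ha i).1, (T i).norm_map]
  exact mul_le_of_le_one_right (ha i).1 hx

theorem ConvexTransitive.exists_norm_sub_sum_lt (h : ConvexTransitive 𝕜 E) {x y : E}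
    (hx : ‖x‖ = 1) (hy : ‖y‖ ≤ 1) {ε : ℝ} (hε : 0 < ε) :
    ∃ (n : ℕ) (T : Fin n → (E ≃ₗᵢ[𝕜] E)) (a : Fin n → ℝ),
      (∀ i, 0 ≤ a i) ∧ ∑ i, a i = 1 ∧ ‖y - ∑ i, (a i : 𝕜) • T i x‖ < ε := by
  have hmem : y ∈ closure (⋃ n : ℕ, convexComb 𝕜 n x) := by
    rw [h x (mem_sphere_zero_iff_norm.2 hx)]
    exact mem_closedBall_zero_iff.2 hy
  obtain ⟨z, hz, hd⟩ := Metric.mem_closure_iff.1 hmem ε hε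
  obtain ⟨n, T, a, ha, ha1, rfl⟩ := mem_iUnion.1 hz
  exact ⟨n, T, a, fun i => (ha i).1, ha1, by rwa [← dist_eq_norm]⟩

end Hull

namespace ZeroAtInftyContinuousMap

variable {L : Type*} [TopologicalSpace L]

section ClopenBasis

variable [LocallyCompactSpace L] [T2Space L]

theorem totallySeparatedSpace_of_convexTransitive (hL : ConvexTransitive ℝ C₀(L, ℝ)) :
    TotallySeparatedSpace L := by
  refine totallySeparatedSpace_iff_exists_isClopen.2 fun s t hst => ?_
  obtain ⟨U, V, hU, hV, hsU, htV, hUV⟩ := t2_separation hst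
  obtain ⟨f, hf1, hf0, hf⟩ := exists_bump isCompact_singleton hU (singleton_subset_iff.2 hsU)
  obtain ⟨g, hg1, hg0, hg⟩ := exists_bump isCompact_singleton hV (singleton_subset_iff.2 htV)
  replace hf1 := hf1 s rfl
  replace hg1 := hg1 t rfl
  have hfn : ‖f‖ = 1 := by
    refine le_antisymm ((norm_le_iff_forall zero_le_one).2 fun x => ?_) ?_
    · rw [Real.norm_of_nonneg (hf x).1]
      exact (hf x).2
    · have := norm_apply_le_norm f s
      rwa [hf1, norm_one] at this
  have hn : ‖f - g‖ ≤ 1 := (norm_le_iff_forall zero_le_one).2 fun x => by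
    rw [sub_apply, Real.norm_eq_abs, abs_le]
    constructor <;> linarith [hf x, hg x]
  obtain ⟨n, T, a, ha, ha1, hT⟩ := hL.exists_norm_sub_sum_lt hfn hn (half_pos one_pos)
  choose φ σ hσ hφ using fun i => exists_homeomorph_of_isometry (T i)
  have hval : ∀ x, |f x - g x - ∑ i, a i * (σ i x * f (φ i x))| < 1 / 2 := fun x => by
    have := (norm_apply_le_norm _ x).trans_lt hT
    simpa [finsetSum_apply, hφ] using this
  obtain ⟨i, hi⟩ : ∃ i, σ i s ≠ σ i t := by
    by_contra! hcon
    have h1 := (abs_lt.1 (hval s)).2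
    have h2 := (abs_lt.1 (hval t)).1
    rw [hf1, hg0 s (disjoint_left.1 hUV hsU)] at h1
    rw [hg1, hf0 t (disjoint_right.1 hUV htV)] at h2
    have h3 : ∑ i, a i * (σ i s * f (φ i s)) - ∑ i, a i * (σ i t * f (φ i t)) ≤ ∑ i, a i := by
      rw [← Finset.sum_sub_distrib]
      refine Finset.sum_le_sum fun i _ => ?_
      rw [← mul_sub, hcon i]
      refine mul_le_of_le_one_right (ha i) ?_
      rcases hσ i t with h | h <;> rw [h] <;> linarith [hf (φ i s), hf (φ i t)]
    linarith
  have hsep : ∀ x, ∃ e : C₀(L, ℝ), (∀ y, 0 ≤ e y) ∧ T i e x = σ i x := fun x => by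
    obtain ⟨e, h1, -, he⟩ := exists_bump (isCompact_singleton (x := φ i x)) isOpen_univ
      (subset_univ _)
    exact ⟨e, fun y => (he y).1, by rw [hφ, h1 _ rfl, mul_one]⟩
  have hopen : IsOpen {x | σ i x = 1} := isOpen_iff_mem_nhds.2 fun x hx => by
    obtain ⟨e, he, hex⟩ := hsep x
    rw [mem_ofPred_eq] at hx
    have hpos : 0 < T i e x := by rw [hex, hx]; exact one_pos
    filter_upwards [(map_continuous (T i e)).continuousAt.eventually (lt_mem_nhds hpos)] with y hy
    refine (hσ i y).resolve_right fun h => ?_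
    rw [hφ, h] at hy
    linarith [he (φ i y)]
  have hclosed : IsClosed {x | σ i x = 1} := isOpen_compl_iff.1 <| isOpen_iff_mem_nhds.2
    fun x hx => by
    obtain ⟨e, he, hex⟩ := hsep x
    have hneg : T i e x < 0 := by
      rw [hex, (hσ i x).resolve_left hx]
      norm_num
    filter_upwards [(map_continuous (T i e)).continuousAt.eventually (gt_mem_nhds hneg)] with y hy
    intro h
    rw [mem_ofPred_eq] at h
    rw [hφ, h] at hy
    linarith [he (φ i y)]
  have hclopen : IsClopen {x | σ i x = 1} := ⟨hclosed, hopen⟩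
  rcases hσ i s with h | h
  · exact ⟨_, hclopen, h, fun h' => hi (h.trans (Eq.symm h'))⟩
  · refine ⟨_, hclopen.compl, fun h' => ?_, fun h' => h' ?_⟩
    · rw [mem_ofPred_eq, h] at h'
      norm_num at h'
    · exact (hσ i t).resolve_right fun ht => hi (h.trans ht.symm)

end ClopenBasis

section Rotation

variable {𝕜 : Type*} [RCLike 𝕜] {X : Type*} [NormedAddCommGroup X] [NormedSpace 𝕜 X]

/-- Substitution by a homeomorphism followed by a locally constant field of rotations. -/
def weightedComp (φ : L ≃ₜ L) (ρ : L → (X ≃ₗᵢ[𝕜] X)) (hρ : IsLocallyConstant ρ)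
    (f : C₀(L, X)) : C₀(L, X) where
  toFun t := ρ t (f (φ t))
  continuous_toFun := continuous_iff_continuousAt.2 fun t =>
    (((ρ t).continuous.comp ((map_continuous f).comp φ.continuous)).continuousAt).congr <|
      (hρ.eventually_eq t).mono fun s hs => by simp [hs]
  zero_at_infty' := by
    rw [tendsto_zero_iff_norm_tendsto_zero]
    have := ((zero_at_infty f).comp φ.isClosedEmbedding.tendsto_cocompact).norm
    simpa [Function.comp_def] using this

/-- `weightedComp` as a rotation of `C₀(L, X)`. -/
def weightedCompIsometry (φ : L ≃ₜ L) (ρ : L → (X ≃ₗᵢ[𝕜] X)) (hρ : IsLocallyConstant ρ) :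
    C₀(L, X) ≃ₗᵢ[𝕜] C₀(L, X) where
  toFun := weightedComp φ ρ hρ
  map_add' f g := ext fun t => (ρ t).map_add _ _
  map_smul' c f := ext fun t => (ρ t).map_smul _ _
  invFun := weightedComp φ.symm (fun t => (ρ (φ.symm t)).symm)
    ((hρ.comp_continuous φ.symm.continuous).comp LinearIsometryEquiv.symm)
  left_inv f := ext fun t => by simp [weightedComp]
  right_inv f := ext fun t => by simp [weightedComp]
  norm_map' f := by
    refine le_antisymm ((norm_le_iff_forall (norm_nonneg _)).2 fun t => ?_)
      ((norm_le_iff_forall (norm_nonneg _)).2 fun t => ?_)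
    · exact ((ρ t).norm_map _).le.trans (norm_apply_le_norm f _)
    · refine le_trans (le_of_eq ?_) (norm_apply_le_norm (weightedComp φ ρ hρ f) (φ.symm t))
      simp [weightedComp]

theorem weightedCompIsometry_apply (φ : L ≃ₜ L) (ρ : L → (X ≃ₗᵢ[𝕜] X))
    (hρ : IsLocallyConstant ρ) (f : C₀(L, X)) (t : L) :
    weightedCompIsometry φ ρ hρ f t = ρ t (f (φ t)) :=
  rfl

theorem exists_rotation_on_isClopen {D : Set L} (hD : IsClopen D) (T : X ≃ₗᵢ[𝕜] X) :
    ∃ R : C₀(L, X) ≃ₗᵢ[𝕜] C₀(L, X),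
      (∀ f, ∀ t ∈ D, R f t = T (f t)) ∧ ∀ f, ∀ t ∉ D, R f t = f t := by
  classical
  have hρ : IsLocallyConstant fun t => if t ∈ D then T else LinearIsometryEquiv.refl 𝕜 X := by
    refine IsLocallyConstant.iff_eventually_eq _ |>.2 fun t => ?_
    by_cases ht : t ∈ D
    · filter_upwards [hD.isOpen.mem_nhds ht] with s hs
      simp [hs, ht]
    · filter_upwards [hD.compl.isOpen.mem_nhds ht] with s hs
      rw [if_neg hs, if_neg ht]
  refine ⟨weightedCompIsometry (Homeomorph.refl L) _ hρ, fun f t ht => ?_, fun f t ht => ?_⟩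
  · simp [weightedCompIsometry_apply, ht]
  · simp [weightedCompIsometry_apply, ht]

variable [NormedSpace ℝ X] {K : Set C₀(L, X)}

theorem exists_mem_eq_zero_on_isClopen (hK : Convex ℝ K)
    (hKi : ∀ (T : C₀(L, X) ≃ₗᵢ[𝕜] C₀(L, X)), ∀ f ∈ K, T f ∈ K)
    {D : Set L} (hD : IsClopen D) {f : C₀(L, X)} (hf : f ∈ K) :
    ∃ g ∈ K, (∀ t ∈ D, g t = 0) ∧ ∀ t ∉ D, g t = f t := by
  obtain ⟨R, hR, hR'⟩ := exists_rotation_on_isClopen hD (LinearIsometryEquiv.neg 𝕜 (E := X))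
  refine ⟨(1 / 2 : ℝ) • f + (1 / 2 : ℝ) • R f,
    hK hf (hKi R f hf) (by norm_num) (by norm_num) (by norm_num), fun t ht => ?_, fun t ht => ?_⟩
  · simp [hR f t ht]
  · rw [add_apply, smul_apply, smul_apply, hR' f t ht, ← add_smul]
    norm_num

variable [IsScalarTower ℝ 𝕜 X]

theorem exists_mem_near_const_on_isClopen (hX : ConvexTransitive 𝕜 X) (hK : Convex ℝ K)
    (hKi : ∀ (T : C₀(L, X) ≃ₗᵢ[𝕜] C₀(L, X)), ∀ f ∈ K, T f ∈ K)
    {x y : X} (hx : ‖x‖ = 1) (hy : ‖y‖ ≤ 1) {ε : ℝ} (hε : 0 < ε)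
    {D : Set L} (hD : IsClopen D) {f : C₀(L, X)} (hf : f ∈ K) (hfx : ∀ t ∈ D, ‖f t - x‖ ≤ ε) :
    ∃ g ∈ K, (∀ t ∈ D, ‖g t - y‖ ≤ 2 * ε) ∧ ∀ t ∉ D, g t = f t := by
  obtain ⟨n, T, a, ha, ha1, hT⟩ := hX.exists_norm_sub_sum_lt hx hy hε
  choose R hR hR' using fun i => exists_rotation_on_isClopen hD (T i)
  refine ⟨∑ i, a i • R i f, hK.sum_mem (fun i _ => ha i) ha1 fun i _ => hKi _ _ hf,
    fun t ht => ?_, fun t ht => ?_⟩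
  · have h1 : (∑ i, a i • R i f) t - ∑ i, (a i : 𝕜) • T i x = ∑ i, a i • T i (f t - x) := by
      rw [finsetSum_apply, ← Finset.sum_sub_distrib]
      refine Finset.sum_congr rfl fun i _ => ?_
      rw [smul_apply, hR i f t ht, ← RCLike.real_smul_eq_coe_smul (K := 𝕜), ← smul_sub, map_sub]
    have h2 : ‖∑ i, a i • T i (f t - x)‖ ≤ ε := by
      calc _ ≤ ∑ i, a i * ε := by
            refine (norm_sum_le _ _).trans (Finset.sum_le_sum fun i _ => ?_)
            rw [norm_smul, Real.norm_of_nonneg (ha i), (T i).norm_map]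
            exact mul_le_mul_of_nonneg_left (hfx t ht) (ha i)
        _ = ε := by rw [← Finset.sum_mul, ha1, one_mul]
    calc _ = ‖∑ i, a i • T i (f t - x) - (y - ∑ i, (a i : 𝕜) • T i x)‖ := by
          rw [← h1]
          congr 1
          abel
      _ ≤ _ := (norm_sub_le _ _).trans (by linarith)
  · rw [finsetSum_apply]
    simp only [smul_apply, hR' _ f t ht]
    rw [← Finset.sum_smul, ha1, one_smul]

theorem exists_mem_near_on_isClopen [LocallyCompactSpace L] [T2Space L]
    [TotallyDisconnectedSpace L] (hX : ConvexTransitive 𝕜 X) (hK : Convex ℝ K)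
    (hKi : ∀ (T : C₀(L, X) ≃ₗᵢ[𝕜] C₀(L, X)), ∀ f ∈ K, T f ∈ K)
    {x : X} (hx : ‖x‖ = 1) {ε : ℝ} (hε : 0 < ε) {C : Set L} (hC : IsClopen C)
    {f : C₀(L, X)} (hf : f ∈ K) (hfx : ∀ t ∈ C, ‖f t - x‖ ≤ ε)
    {G : C₀(L, X)} (hG : ‖G‖ ≤ 1) :
    ∃ g ∈ K, (∀ t ∈ C, ‖g t - G t‖ ≤ 3 * ε) ∧ ∀ t ∉ C, ‖g t‖ ≤ 3 * ε := by
  let p : Set L → Prop := fun S => ∃ B, IsClopen B ∧ S ⊆ B ∧ ∀ D ⊆ B, IsClopen D →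
    ∀ h ∈ K, (∀ t ∈ C ∩ D, ‖h t - x‖ ≤ ε) → ∃ g ∈ K, (∀ t ∉ D, g t = h t) ∧
      (∀ t ∈ C ∩ D, ‖g t - G t‖ ≤ 3 * ε) ∧ ∀ t ∈ D \ C, ‖g t‖ ≤ 3 * ε
  have hp : p {t | ε ≤ ‖G t‖} := by
    refine (isCompact_le_norm G hε).induction_on (p := p) ?_ ?_ ?_ ?_
    · refine ⟨∅, isClopen_empty, subset_rfl, fun D hD _ h hh _ => ⟨h, hh, fun _ _ => rfl, ?_, ?_⟩⟩
      · exact fun t ht => absurd (hD ht.2) (notMem_empty t)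
      · exact fun t ht => absurd (hD ht.1) (notMem_empty t)
    · rintro S S' hSS' ⟨B, hB, hS'B, h⟩
      exact ⟨B, hB, hSS'.trans hS'B, h⟩
    · rintro S₁ S₂ ⟨B₁, hB₁, hS₁, h₁⟩ ⟨B₂, hB₂, hS₂, h₂⟩
      refine ⟨B₁ ∪ B₂, hB₁.union hB₂, union_subset_union hS₁ hS₂, fun D hD hDc h hh hhx => ?_⟩
      obtain ⟨g₁, hg₁, heq₁, hin₁, hout₁⟩ := h₁ (D ∩ B₁) inter_subset_right (hDc.inter hB₁) h hh
        fun t ht => hhx t ⟨ht.1, ht.2.1⟩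
      obtain ⟨g₂, hg₂, heq₂, hin₂, hout₂⟩ := h₂ (D \ B₁)
        (fun t ht => (hD ht.1).resolve_left ht.2) (hDc.diff hB₁) g₁ hg₁ fun t ht => by
          rw [heq₁ t fun h' => ht.2.2 h'.2]
          exact hhx t ⟨ht.1, ht.2.1⟩
      refine ⟨g₂, hg₂, fun t ht => ?_, fun t ht => ?_, fun t ht => ?_⟩
      · rw [heq₂ t fun h' => ht h'.1, heq₁ t fun h' => ht h'.1]
      · by_cases htB : t ∈ B₁
        · rw [heq₂ t fun h' => h'.2 htB]
          exact hin₁ t ⟨ht.1, ht.2, htB⟩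
        · exact hin₂ t ⟨ht.1, ht.2, htB⟩
      · by_cases htB : t ∈ B₁
        · rw [heq₂ t fun h' => h'.2 htB]
          exact hout₁ t ⟨⟨ht.1, htB⟩, ht.2⟩
        · exact hout₂ t ⟨⟨ht.1, htB⟩, ht.2⟩
    · intro t _
      by_cases ht : t ∈ C
      · have hnear : {s | ‖G s - G t‖ < ε} ∈ 𝓝 t := by
          have := Metric.continuousAt_iff'.1 ((map_continuous G).continuousAt (x := t)) ε hε
          simp only [dist_eq_norm] at this
          exact this
        obtain ⟨B, hB, htB, hBs⟩ := loc_compact_Haus_tot_disc_of_zero_dim.mem_nhds_iff.1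
          (Filter.inter_mem hnear (hC.isOpen.mem_nhds ht))
        refine ⟨B, mem_nhdsWithin_of_mem_nhds ((IsClopen.isOpen hB).mem_nhds htB), B, hB,
          subset_rfl, fun D hD hDc h hh hhx => ?_⟩
        obtain ⟨g, hg, hgD, hgo⟩ := exists_mem_near_const_on_isClopen hX hK hKi hx
          ((norm_apply_le_norm G t).trans hG) hε hDc hh
          fun s hs => hhx s ⟨(hBs (hD hs)).2, hs⟩
        refine ⟨g, hg, hgo, fun s hs => ?_, fun s hs => absurd (hBs (hD hs.1)).2 hs.2⟩
        have h1 : ‖G s - G t‖ < ε := (hBs (hD hs.2)).1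
        have h2 := norm_sub_le_norm_sub_add_norm_sub (g s) (G t) (G s)
        rw [norm_sub_rev (G t)] at h2
        linarith [hgD s hs.2]
      · refine ⟨Cᶜ, mem_nhdsWithin_of_mem_nhds (hC.compl.isOpen.mem_nhds ht), Cᶜ, hC.compl,
          subset_rfl, fun D hD hDc h hh _ => ?_⟩
        obtain ⟨g, hg, hg0, hgo⟩ := exists_mem_eq_zero_on_isClopen hK hKi hDc hh
        refine ⟨g, hg, hgo, fun s hs => absurd hs.1 (hD hs.2), fun s hs => ?_⟩
        rw [hg0 s hs.1, norm_zero]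
        positivity
  obtain ⟨B, hB, hQB, h⟩ := hp
  obtain ⟨g, hg, -, hgin, hgout⟩ := h B subset_rfl hB f hf fun t ht => hfx t ht.1
  obtain ⟨g', hg', hg'0, hg'eq⟩ := exists_mem_eq_zero_on_isClopen hK hKi hB.compl hg
  refine ⟨g', hg', fun t ht => ?_, fun t ht => ?_⟩
  · by_cases htB : t ∈ B
    · rw [hg'eq t (not_not.2 htB)]
      exact hgin t ⟨ht, htB⟩
    · have : ‖G t‖ < ε := not_le.1 fun h' => htB (hQB h')
      rw [hg'0 t htB, zero_sub, norm_neg]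
      linarith
  · by_cases htB : t ∈ B
    · rw [hg'eq t (not_not.2 htB)]
      exact hgout t ⟨htB, ht⟩
    · rw [hg'0 t htB, norm_zero]
      positivity

theorem mem_of_isClosed_of_convex_of_rotation_invariant [LocallyCompactSpace L] [T2Space L]
    (hL : ConvexTransitive ℝ C₀(L, ℝ)) (hX : ConvexTransitive 𝕜 X)
    (hKcl : IsClosed K) (hK : Convex ℝ K)
    (hKi : ∀ (T : C₀(L, X) ≃ₗᵢ[𝕜] C₀(L, X)), ∀ f ∈ K, T f ∈ K)
    {F : C₀(L, X)} (hF : F ∈ K) (hF1 : ‖F‖ = 1) {G : C₀(L, X)} (hG : ‖G‖ ≤ 1) : G ∈ K := by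
  have := totallySeparatedSpace_of_convexTransitive hL
  rw [← hKcl.closure_eq, Metric.mem_closure_iff]
  intro δ hδ
  obtain ⟨ε, hε, hεδ⟩ : ∃ ε > 0, 4 * ε < δ := ⟨δ / 5, by positivity, by linarith⟩
  obtain ⟨t₀, ht₀⟩ := exists_norm_apply_eq_norm F (by
    rw [← norm_ne_zero_iff, hF1]
    exact one_ne_zero)
  rw [hF1] at ht₀
  have hnear : {s | ‖F s - F t₀‖ < ε} ∈ 𝓝 t₀ := by
    have := Metric.continuousAt_iff'.1 ((map_continuous F).continuousAt (x := t₀)) ε hε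
    simp only [dist_eq_norm] at this
    exact this
  obtain ⟨N, hN, hNt⟩ := exists_compact_mem_nhds t₀
  obtain ⟨A, hA, htA, hAs⟩ := loc_compact_Haus_tot_disc_of_zero_dim.mem_nhds_iff.1
    (Filter.inter_mem hnear hNt)
  replace hA : IsClopen A := hA
  obtain ⟨χ, hχ1, hχ0, hχ⟩ := exists_bump
    (hN.of_isClosed_subset hA.isClosed fun t ht => (hAs ht).2) hA.isOpen subset_rfl
  obtain ⟨b, hb1, -, hb⟩ := exists_bump (isCompact_le_norm G hε) isOpen_univ (subset_univ _)
  have hnorm : ∀ e : C₀(L, ℝ), (∀ t, 0 ≤ e t ∧ e t ≤ 1) → ‖e‖ ≤ 1 := fun e he =>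
    (norm_le_iff_forall zero_le_one).2 fun t => by
      rw [Real.norm_of_nonneg (he t).1]
      exact (he t).2
  have hχn : ‖χ‖ = 1 := le_antisymm (hnorm χ hχ) <| by
    have := norm_apply_le_norm χ t₀
    rwa [hχ1 t₀ htA, norm_one] at this
  obtain ⟨n, T, a, ha, ha1, hT⟩ := hL.exists_norm_sub_sum_lt hχn (hnorm b hb) hε
  choose φ σ hσ hφ using fun i => exists_homeomorph_of_isometry (T i)
  have hH : ∀ i, ∃ g ∈ K, (∀ t ∈ φ i ⁻¹' A, ‖g t - G t‖ ≤ 3 * ε) ∧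
      ∀ t ∉ φ i ⁻¹' A, ‖g t‖ ≤ 3 * ε := fun i =>
    exists_mem_near_on_isClopen hX hK hKi ht₀ hε (hA.preimage (φ i).continuous)
      (hKi (weightedCompIsometry (φ i) (fun _ => LinearIsometryEquiv.refl 𝕜 X)
        (IsLocallyConstant.const _)) F hF) (fun t ht => le_of_lt (hAs ht).1) hG
  choose H hHK hHin hHout using hH
  refine ⟨∑ i, a i • H i, hK.sum_mem (fun i _ => ha i) ha1 fun i _ => hHK i, ?_⟩
  rw [dist_comm, dist_eq_norm]
  refine lt_of_le_of_lt ((norm_le_iff_forall (by positivity)).2 fun t => ?_) hεδ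
  have hHw : ∀ i, ‖H i t - χ (φ i t) • G t‖ ≤ 3 * ε := fun i => by
    by_cases ht : φ i t ∈ A
    · rw [hχ1 _ ht, one_smul]
      exact hHin i t ht
    · rw [hχ0 _ ht, zero_smul, sub_zero]
      exact hHout i t ht
  set w := ∑ i, a i * χ (φ i t) with hw
  have hw1 : w ≤ 1 := by
    rw [← ha1]
    exact Finset.sum_le_sum fun i _ => mul_le_of_le_one_right (ha i) (hχ _).2
  have hw0 : 0 ≤ w := Finset.sum_nonneg fun i _ => mul_nonneg (ha i) (hχ _).1
  have hwG : (1 - w) * ‖G t‖ ≤ ε := by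
    have hGt : ‖G t‖ ≤ 1 := (norm_apply_le_norm G t).trans hG
    by_cases ht : ε ≤ ‖G t‖
    · have h1 := (norm_apply_le_norm _ t).trans_lt hT
      have h2 : |1 - ∑ i, a i * (σ i t * χ (φ i t))| < ε := by
        simpa [finsetSum_apply, hφ, hb1 t ht] using h1
      have h3 : ∑ i, a i * (σ i t * χ (φ i t)) ≤ w := by
        refine Finset.sum_le_sum fun i _ => mul_le_mul_of_nonneg_left ?_ (ha i)
        rcases hσ i t with h | h <;> rw [h] <;> linarith [hχ (φ i t)]
      nlinarith [(abs_lt.1 h2).2, norm_nonneg (G t)]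
    · nlinarith [not_le.1 ht, norm_nonneg (G t)]
  have hsplit : (∑ i, a i • H i - G) t =
      ∑ i, a i • (H i t - χ (φ i t) • G t) - (1 - w) • G t := by
    simp only [sub_apply, finsetSum_apply, smul_apply, smul_sub, Finset.sum_sub_distrib, smul_smul]
    rw [← Finset.sum_smul, ← hw, sub_smul, one_smul]
    abel
  have hsum : ‖∑ i, a i • (H i t - χ (φ i t) • G t)‖ ≤ 3 * ε := by
    calc _ ≤ ∑ i, a i * (3 * ε) := by
          refine (norm_sum_le _ _).trans (Finset.sum_le_sum fun i _ => ?_)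
          rw [norm_smul, Real.norm_of_nonneg (ha i)]
          exact mul_le_mul_of_nonneg_left (hHw i) (ha i)
      _ = 3 * ε := by rw [← Finset.sum_mul, ha1, one_mul]
  rw [hsplit]
  refine (norm_sub_le _ _).trans ?_
  rw [norm_smul, Real.norm_of_nonneg (sub_nonneg.2 hw1)]
  linarith

end Rotation

end ZeroAtInftyContinuousMap

end ConvexTransitivity

theorem C0_vectorValued_convexTransitive (𝕜 : Type*) [RCLike 𝕜]
    (L : Type*) [TopologicalSpace L] [LocallyCompactSpace L] [T2Space L]
    (hL : ConvexTransitive ℝ C₀(L, ℝ))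
    (X : Type*) [NormedAddCommGroup X] [NormedSpace 𝕜 X] [CompleteSpace X]
    (hX : ConvexTransitive 𝕜 X) :
    ConvexTransitive 𝕜 C₀(L, X) := by
  intro F hF
  rw [mem_sphere_zero_iff_norm] at hF
  let _ : NormedSpace ℝ X := NormedSpace.restrictScalars ℝ 𝕜 X
  have : IsScalarTower ℝ 𝕜 X := IsScalarTower.restrictScalars ℝ 𝕜 X
  have : IsScalarTower ℝ 𝕜 C₀(L, X) :=
    ⟨fun r c f => ZeroAtInftyContinuousMap.ext fun t => smul_assoc r c (f t)⟩
  refine Set.Subset.antisymm (closure_iUnion_convexComb_subset_closedBall hF.le) fun G hG => ?_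
  refine ZeroAtInftyContinuousMap.mem_of_isClosed_of_convex_of_rotation_invariant hL hX
    isClosed_closure ?_ (fun T f hf => map_mem_closure_iUnion_convexComb T hf)
    (self_mem_closure_iUnion_convexComb F) hF (mem_closedBall_zero_iff.1 hG)
  rw [iUnion_convexComb_eq_convexHull]
  exact (convex_convexHull ℝ _).closure
end

section
/- Let X be a Banach space with ρ(X) = 2, i.e. for every δ > 0 there exists a bounded linear projection P : X → X (P² = P) with ‖P‖ = 1 and ‖I − P‖ > 2 − δ. Then for every δ ∈ (0,1) there exist x, y in the unit sphere S_X with ‖x − y‖ > 2(1 − δ) and ‖x + y‖ > 2(1 − δ); in particular, X is not uniformly non-square. -/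
open Metric Filter

/-- `X` is uniformly non-square if there is `a ∈ (0,1)` such that for all `x, y` in the
closed unit ball, `min (‖x + y‖) (‖x - y‖) ≤ 2a`. -/
def UniformlyNonSquare (X : Type*) [NormedAddCommGroup X] : Prop :=
  ∃ a ∈ Set.Ioo (0:ℝ) 1, ∀ x ∈ closedBall (0:X) 1, ∀ y ∈ closedBall (0:X) 1,
    min ‖x + y‖ ‖x - y‖ ≤ 2 * a

/-- A norm-one projection whose complement has norm more than `2 - δ` yields two unit vectors
whose sum and difference both have norm more than `2 * (1 - δ)`. -/
theorem exists_sphere_of_lt_norm_id_sub_projection {X : Type*} [NormedAddCommGroup X]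
    [NormedSpace ℝ X] {P : X →L[ℝ] X} (hP : P.comp P = P) (hP1 : ‖P‖ = 1) {δ : ℝ} (hδ : δ < 1)
    (h : 2 - δ < ‖ContinuousLinearMap.id ℝ X - P‖) :
    ∃ x ∈ sphere (0 : X) 1, ∃ y ∈ sphere (0 : X) 1,
      ‖x - y‖ > 2 * (1 - δ) ∧ ‖x + y‖ > 2 * (1 - δ) := by
  have hPle (v : X) : ‖P v‖ ≤ ‖v‖ := by simpa [hP1] using P.le_opNorm v
  obtain ⟨x, hx, hxP⟩ : ∃ x : X, ‖x‖ = 1 ∧ 2 - δ < ‖x - P x‖ := by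
    by_contra! H
    refine h.not_ge (ContinuousLinearMap.opNorm_le_of_unit_norm (by linarith) fun x hx => ?_)
    simpa using H x hx
  have hPx : 1 - δ < ‖P x‖ := by linarith [norm_sub_le x (P x)]
  have hPx1 : ‖P x‖ ≤ 1 := hx ▸ hPle x
  have hpos : 0 < ‖P x‖ := by linarith
  set y : X := ‖P x‖⁻¹ • P x with hy
  have hy1 : ‖y‖ = 1 := by simp [hy, norm_smul, hpos.ne']
  have hPxy : P x = ‖P x‖ • y := by rw [hy, smul_inv_smul₀ hpos.ne']
  have hPy : P y = y := by
    rw [hy, map_smul, ← ContinuousLinearMap.comp_apply, hP]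
  refine ⟨x, by simpa using hx, y, by simpa using hy1, ?_, ?_⟩
  · have hdist : ‖y - P x‖ = 1 - ‖P x‖ := by
      have : y - P x = (1 - ‖P x‖) • y := by rw [sub_smul, one_smul, ← hPxy]
      rw [this, norm_smul, hy1, mul_one, Real.norm_of_nonneg (by linarith)]
    linarith [norm_sub_le_norm_sub_add_norm_sub x y (P x)]
  · have hsum : ‖P (x + y)‖ = ‖P x‖ + 1 := by
      have : P (x + y) = (‖P x‖ + 1) • y := by
        rw [map_add, hPy, add_smul, one_smul, ← hPxy]
      rw [this, norm_smul, hy1, mul_one, Real.norm_of_nonneg (by linarith)]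
    linarith [hPle (x + y)]

theorem not_uniformly_nonsquare_of_coprojection_two (X : Type*) [NormedAddCommGroup X]
    [NormedSpace ℝ X] [CompleteSpace X]
    (hρ : ∀ δ : ℝ, 0 < δ → ∃ P : X →L[ℝ] X, P.comp P = P ∧ ‖P‖ = 1 ∧
      ‖ContinuousLinearMap.id ℝ X - P‖ > 2 - δ) :
    (∀ δ ∈ Set.Ioo (0:ℝ) 1, ∃ x ∈ sphere (0:X) 1, ∃ y ∈ sphere (0:X) 1,
      ‖x - y‖ > 2 * (1 - δ) ∧ ‖x + y‖ > 2 * (1 - δ)) ∧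
    ¬ UniformlyNonSquare X := by
  have key : ∀ δ ∈ Set.Ioo (0:ℝ) 1, ∃ x ∈ sphere (0:X) 1, ∃ y ∈ sphere (0:X) 1,
      ‖x - y‖ > 2 * (1 - δ) ∧ ‖x + y‖ > 2 * (1 - δ) := by
    rintro δ ⟨hδ0, hδ1⟩
    obtain ⟨P, hP, hP1, hIP⟩ := hρ δ hδ0
    exact exists_sphere_of_lt_norm_id_sub_projection hP hP1 hδ1 hIP
  refine ⟨key, ?_⟩
  rintro ⟨a, ⟨ha0, ha1⟩, ha⟩
  obtain ⟨x, hx, y, hy, hsub, hadd⟩ := key (1 - a) ⟨by linarith, by linarith⟩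
  rw [sub_sub_cancel] at hsub hadd
  exact (lt_min hadd hsub).not_ge
    (ha x (sphere_subset_closedBall hx) y (sphere_subset_closedBall hy))
end

section
/- Let X be a Banach space such that ℓ¹(2), i.e. ℝ² with the norm ‖(a,b)‖ = |a| + |b|, is contained almost isometrically in X. Then ρ(X) = 2; that is, for every δ > 0 there exists a bounded linear projection P : X → X (P² = P) with ‖P‖ = 1 and ‖I − P‖ > 2 − δ. -/
open Metric Filter

/-- `ℓ¹(2)`: the space `ℝ²` with the norm `‖(a, b)‖ = |a| + |b|`. -/
noncomputable abbrev ellOneTwo : Type := PiLp 1 (fun _ : Fin 2 => ℝ)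

/-- A functional norming a slight perturbation of the first basis vector towards the second
gives a rank-one projection whose complement almost reaches norm `2`. -/
theorem exists_rankOne_projection_of_ellOneTwo {X : Type*} [NormedAddCommGroup X]
    [NormedSpace ℝ X] {t : ℝ} (ht : 0 < t) (ht' : t ≤ 1 / 8) (ψ : ellOneTwo →ₗ[ℝ] X)
    (hψ : ∀ v : ellOneTwo, ‖v‖ ≤ ‖ψ v‖ ∧ ‖ψ v‖ ≤ (1 + t ^ 2) * ‖v‖) :
    ∃ P : X →L[ℝ] X, P.comp P = P ∧ ‖P‖ = 1 ∧
      2 - 4 * t ≤ ‖ContinuousLinearMap.id ℝ X - P‖ * (1 + t ^ 2) := by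
  have norm_mk (a b : ℝ) : ‖(WithLp.toLp 1 ![a, b] : ellOneTwo)‖ = |a| + |b| := by
    simp [PiLp.norm_eq_of_L1]
  set x := ψ (WithLp.toLp 1 ![1, 0]) with hx
  set y := ψ (WithLp.toLp 1 ![0, 1]) with hy
  have hab (a b : ℝ) : |a| + |b| ≤ ‖a • x + b • y‖ ∧
      ‖a • x + b • y‖ ≤ (1 + t ^ 2) * (|a| + |b|) := by
    have h : a • x + b • y = ψ (WithLp.toLp 1 ![a, b]) := by
      rw [hx, hy, ← map_smul, ← map_smul, ← map_add]
      congr 1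
      ext i
      fin_cases i <;> simp
    rw [h, ← norm_mk]
    exact hψ _
  have hx1 : ‖x‖ ≤ 1 + t ^ 2 := by simpa using (hab 1 0).2
  have hy1 : ‖y‖ ≤ 1 + t ^ 2 := by simpa using (hab 0 1).2
  set z := x + t • y with hz
  have hz1 : 1 + t ≤ ‖z‖ := by simpa [abs_of_pos ht] using (hab 1 t).1
  have hz2 : ‖z‖ ≤ (1 + t ^ 2) * (1 + t) := by simpa [abs_of_pos ht] using (hab 1 t).2
  have hzpos : 0 < ‖z‖ := by linarith
  obtain ⟨g, hg, hgz⟩ := exists_dual_vector ℝ z hzpos.ne'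
  replace hgz : g z = ‖z‖ := by simpa using hgz
  have hgy : 1 - t ≤ g y := by
    have h1 : g x ≤ 1 + t ^ 2 := by
      have := g.le_opNorm x
      rw [hg, one_mul] at this
      exact (le_abs_self _).trans (this.trans hx1)
    have h2 : g x + t * g y = ‖z‖ := by rw [← hgz, hz]; simp
    have h3 : t * (1 - t) ≤ t * g y := by nlinarith
    exact le_of_mul_le_mul_left h3 ht
  refine ⟨g.smulRight (‖z‖⁻¹ • z), ?_, ?_, ?_⟩
  · ext u
    simp [hgz, hzpos.ne']
  · rw [ContinuousLinearMap.norm_smulRight_apply, hg, norm_smul, norm_inv, norm_norm,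
      inv_mul_cancel₀ hzpos.ne', one_mul]
  · set c := g y * ‖z‖⁻¹ with hc
    have hc1 : 1 - 3 * t ≤ c := by
      rw [hc, ← div_eq_mul_inv, le_div_iff₀ hzpos]
      have h := mul_le_mul_of_nonneg_left hz2 (show (0 : ℝ) ≤ 1 - 3 * t by linarith)
      have h4 : (1 - 3 * t) * ((1 + t ^ 2) * (1 + t)) ≤ 1 - t := by
        have : 0 ≤ t * (1 + 2 * t + 2 * t ^ 2 + 3 * t ^ 3) := by positivity
        linarith
      linarith
    have hdiff : (ContinuousLinearMap.id ℝ X - g.smulRight (‖z‖⁻¹ • z)) y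
        = (-c) • x + (1 - c * t) • y := by
      simp only [sub_apply, ContinuousLinearMap.id_apply,
        ContinuousLinearMap.smulRight_apply, smul_smul, hz]
      module
    have hle := (ContinuousLinearMap.id ℝ X - g.smulRight (‖z‖⁻¹ • z)).le_opNorm y
    rw [hdiff] at hle
    have hlow := (hab (-c) (1 - c * t)).1
    have h5 := le_abs_self (1 - c * t)
    have h6 := neg_le_abs (-c)
    have h7 : (1 - 3 * t) * (1 - t) ≤ c * (1 - t) :=
      mul_le_mul_of_nonneg_right hc1 (by linarith)
    have h8 := mul_le_mul_of_nonneg_left hy1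
      (norm_nonneg (ContinuousLinearMap.id ℝ X - g.smulRight (‖z‖⁻¹ • z)))
    nlinarith [sq_nonneg t]

theorem coprojection_two_of_contains_ellOneTwo (X : Type*) [NormedAddCommGroup X]
    [NormedSpace ℝ X] [CompleteSpace X]
    (hemb : ∀ ε : ℝ, 0 < ε → ∃ ψ : ellOneTwo →ₗ[ℝ] X,
      ∀ v : ellOneTwo, ‖v‖ ≤ ‖ψ v‖ ∧ ‖ψ v‖ ≤ (1 + ε) * ‖v‖) :
    ∀ δ : ℝ, 0 < δ → ∃ P : X →L[ℝ] X, P.comp P = P ∧ ‖P‖ = 1 ∧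
      ‖ContinuousLinearMap.id ℝ X - P‖ > 2 - δ := by
  intro δ hδ
  obtain ⟨t, ht, ht1, htδ⟩ : ∃ t : ℝ, 0 < t ∧ t ≤ 1 / 8 ∧ t ≤ δ / 8 :=
    ⟨min (1 / 8) (δ / 8), by positivity, min_le_left _ _, min_le_right _ _⟩
  obtain ⟨ψ, hψ⟩ := hemb (t ^ 2) (by positivity)
  obtain ⟨P, hPP, hP, h⟩ := exists_rankOne_projection_of_ellOneTwo ht ht1 ψ hψ
  refine ⟨P, hPP, hP, ?_⟩
  by_contra! hlt
  have h1 : ‖ContinuousLinearMap.id ℝ X - P‖ * (1 + t ^ 2) ≤ (2 - 8 * t) * (1 + t ^ 2) :=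
    mul_le_mul_of_nonneg_right (by linarith) (by positivity)
  nlinarith [pow_pos ht 3]
end

section
/- Let X be a Banach space with sup_{x ∈ S_X} η(X, x) = 2, where η(X, x) = limsup_{‖h‖→0, h≠0} (‖x+h‖ + ‖x−h‖ − 2)/‖h‖. Then ρ(X) = 2; that is, for every δ > 0 there exists a bounded linear projection P : X → X (P² = P) with ‖P‖ = 1 and ‖I − P‖ > 2 − δ. -/
open Metric Filter

/-- The roughness modulus `η(X, x) = limsup_{‖h‖ → 0, h ≠ 0} (‖x+h‖ + ‖x-h‖ - 2)/‖h‖`. -/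
noncomputable def eta (X : Type*) [NormedAddCommGroup X] (x : X) : ℝ :=
  Filter.limsup (fun h : X => (‖x + h‖ + ‖x - h‖ - 2) / ‖h‖) (nhdsWithin (0:X) {(0:X)}ᶜ)

/-- The symmetric difference quotient of the norm at a unit vector is nonnegative. -/
lemma norm_add_add_norm_sub_quotient_nonneg {X : Type*} [NormedAddCommGroup X] [NormedSpace ℝ X]
    {x : X} (hx : ‖x‖ = 1) (h : X) : 0 ≤ (‖x + h‖ + ‖x - h‖ - 2) / ‖h‖ := by
  have h2 : ‖(x + h) + (x - h)‖ = 2 := by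
    rw [show (x + h) + (x - h) = (2 : ℝ) • x by module, norm_smul, hx]
    norm_num
  have := norm_add_le (x + h) (x - h)
  exact div_nonneg (by linarith) (norm_nonneg _)

/-- A lower bound for the roughness modulus is attained along arbitrarily small increments. -/
lemma exists_small_of_lt_eta {X : Type*} [NormedAddCommGroup X] [NormedSpace ℝ X]
    {x : X} (hx : ‖x‖ = 1) {c r : ℝ} (hr : 0 < r) (hc : c < eta X x) :
    ∃ h : X, h ≠ 0 ∧ ‖h‖ < r ∧ c * ‖h‖ < ‖x + h‖ + ‖x - h‖ - 2 := by
  have : Nontrivial X := ⟨x, 0, by rintro rfl; simp at hx⟩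
  have : (nhdsWithin (0 : X) {(0 : X)}ᶜ).NeBot := Module.punctured_nhds_neBot ℝ X 0
  have hbdd : IsBoundedUnder (· ≥ ·) (nhdsWithin (0 : X) {(0 : X)}ᶜ)
      (fun h : X => (‖x + h‖ + ‖x - h‖ - 2) / ‖h‖) :=
    isBoundedUnder_of ⟨0, fun h => norm_add_add_norm_sub_quotient_nonneg hx h⟩
  have hfreq := frequently_lt_of_lt_limsup hbdd.isCoboundedUnder_le hc
  have hball : ∀ᶠ h : X in nhdsWithin (0 : X) {(0 : X)}ᶜ, h ∈ ball (0 : X) r :=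
    mem_nhdsWithin_of_mem_nhds (ball_mem_nhds 0 hr)
  obtain ⟨h, hlt, hmem, hne⟩ := (hfreq.and_eventually
    (hball.and self_mem_nhdsWithin)).exists
  have hne : h ≠ 0 := hne
  exact ⟨h, hne, by simpa using hmem, (lt_div_iff₀ (norm_pos_iff.2 hne)).1 hlt⟩

/-- A small increment showing roughness of the norm at a unit vector yields a rank-one
norm-one projection whose complementary projection has large norm. -/
lemma exists_projection_of_rough {X : Type*} [NormedAddCommGroup X] [NormedSpace ℝ X]
    {x h : X} (hx : ‖x‖ = 1) (hne : h ≠ 0) {ε : ℝ} (hε : ε ≤ 1) (hh : ‖h‖ ≤ 1 / 4)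
    (hrough : (2 - ε) * ‖h‖ < ‖x + h‖ + ‖x - h‖ - 2) :
    ∃ P : X →L[ℝ] X, P.comp P = P ∧ ‖P‖ = 1 ∧
      (1 - ε) * (2 - 4 * ‖h‖) ≤ ‖ContinuousLinearMap.id ℝ X - P‖ := by
  have ht : 0 < ‖h‖ := norm_pos_iff.2 hne
  have hsub : ‖x‖ - ‖h‖ ≤ ‖x - h‖ := norm_sub_norm_le x h
  have hadd : ‖x‖ - ‖h‖ ≤ ‖x + h‖ := by simpa using norm_sub_norm_le x (-h)
  have hsub' : ‖x - h‖ ≤ ‖x‖ + ‖h‖ := norm_sub_le x h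
  have hs : 0 < ‖x - h‖ := by linarith
  obtain ⟨f, hf, hfx⟩ := exists_dual_vector ℝ (x + h) (by linarith : 0 < ‖x + h‖).ne'
  obtain ⟨g, hg, hgx⟩ := exists_dual_vector ℝ (x - h) hs.ne'
  have bound : ∀ k : StrongDual ℝ X, ‖k‖ = 1 → ∀ v, |k v| ≤ ‖v‖ := fun k hk v => by
    simpa [hk] using k.le_opNorm v
  have hf1 := abs_le.1 (bound f hf x)
  have hf2 := abs_le.1 (bound f hf h)
  have hg1 := abs_le.1 (bound g hg x)
  have hg2 := abs_le.1 (bound g hg h)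
  simp only [map_add, map_sub, RCLike.ofReal_real_eq_id, id] at hfx hgx
  set y : X := ‖x - h‖⁻¹ • (x - h) with hy
  have hynorm : ‖y‖ = 1 := by
    rw [hy, norm_smul, norm_inv, norm_norm, inv_mul_cancel₀ hs.ne']
  have hgy : g y = 1 := by
    rw [hy, map_smul, map_sub, hgx, smul_eq_mul, inv_mul_cancel₀ hs.ne']
  have hfy : 1 - 4 * ‖h‖ ≤ f y := by
    rw [hy, map_smul, map_sub, smul_eq_mul, inv_mul_eq_div, le_div_iff₀ hs]
    nlinarith
  refine ⟨g.smulRight y, ?_, ?_, ?_⟩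
  · ext v
    simp [hgy]
  · rw [ContinuousLinearMap.norm_smulRight_apply, hg, hynorm, one_mul]
  · have hop := (ContinuousLinearMap.id ℝ X - g.smulRight y).le_opNorm h
    have hval := (abs_le.1 (bound f hf (h - g h • y))).2
    simp only [map_sub, map_smul, smul_eq_mul] at hval
    simp only [sub_apply, ContinuousLinearMap.id_apply,
      ContinuousLinearMap.smulRight_apply] at hop
    refine le_of_mul_le_mul_right ?_ ht
    have hfh : (1 - ε) * ‖h‖ ≤ f h := by linarith
    have hgh : (1 - ε) * ‖h‖ ≤ -g h := by linarith
    have hmul : (1 - ε) * ‖h‖ * (1 - 4 * ‖h‖) ≤ -g h * f y :=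
      mul_le_mul hgh hfy (by linarith)
        ((mul_nonneg (by linarith) ht.le).trans hgh)
    linarith

theorem coprojection_two_of_sup_eta_two (X : Type*) [NormedAddCommGroup X]
    [NormedSpace ℝ X] [CompleteSpace X]
    (h : (⨆ x : sphere (0:X) 1, eta X (x : X)) = 2) :
    ∀ δ : ℝ, 0 < δ → ∃ P : X →L[ℝ] X, P.comp P = P ∧ ‖P‖ = 1 ∧
      ‖ContinuousLinearMap.id ℝ X - P‖ > 2 - δ := by
  intro δ hδ
  have hne : Nonempty (sphere (0 : X) 1) := by
    by_contra hempty
    rw [not_nonempty_iff] at hempty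
    rw [Real.iSup_of_isEmpty] at h
    norm_num at h
  obtain ⟨ε, hε0, hε⟩ := exists_between (show 0 < min (δ / 4) 1 by positivity)
  obtain ⟨hεδ, hε1⟩ := lt_min_iff.1 hε
  obtain ⟨⟨x, hxs⟩, hxη⟩ := exists_lt_of_lt_ciSup (show 2 - ε < _ by rw [h]; linarith)
  have hx : ‖x‖ = 1 := by simpa using hxs
  obtain ⟨v, hv0, hvr, hv⟩ := exists_small_of_lt_eta hx
    (show 0 < min (δ / 16) (1 / 4) by positivity) hxη
  obtain ⟨hvδ, hv4⟩ := lt_min_iff.1 hvr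
  obtain ⟨P, hP, hP1, hPn⟩ := exists_projection_of_rough hx hv0 hε1.le hv4.le hv
  refine ⟨P, hP, hP1, ?_⟩
  have : 0 ≤ ε * ‖v‖ := mul_nonneg hε0.le (norm_nonneg v)
  linarith
end

section
/- Let X be a Banach space and let x, y ∈ X with x ≠ 0. Then the one-sided limit θ = lim_{t→0⁺} (‖x − t y‖ − ‖x + t y‖)/(2t‖x‖) exists, and there is a real number c such that, as t → 0⁺, each of the three quantities (‖x + t(y + θx)‖ − ‖x‖)/t, (‖x − t(y + θx)‖ − ‖x‖)/t, and (‖x + t(y + θx)‖ + ‖x − t(y + θx)‖ − 2‖x‖)/(2t) converges to c. -/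
open Metric Filter

theorem exists_tendsto_norm_add_smul_sub_div {X : Type*} [NormedAddCommGroup X] [NormedSpace ℝ X]
    (x y : X) :
    ∃ p : ℝ, Tendsto (fun t : ℝ => (‖x + t • y‖ - ‖x‖) / t)
      (nhdsWithin 0 (Set.Ioi 0)) (nhds p) := by
  have hf : ConvexOn ℝ Set.univ (fun t : ℝ => ‖x + t • y‖) := by
    refine ⟨convex_univ, fun s _ t _ a b ha hb hab => ?_⟩
    have h : x + (a • s + b • t) • y = a • (x + s • y) + b • (x + t • y) := by
      obtain rfl : b = 1 - a := by linarith
      simp only [smul_eq_mul]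
      module
    calc ‖x + (a • s + b • t) • y‖ ≤ ‖a • (x + s • y)‖ + ‖b • (x + t • y)‖ := by
          rw [h]; exact norm_add_le _ _
      _ = a • ‖x + s • y‖ + b • ‖x + t • y‖ := by
          rw [norm_smul, norm_smul, Real.norm_of_nonneg ha, Real.norm_of_nonneg hb,
            smul_eq_mul, smul_eq_mul]
  have hd := hf.hasDerivWithinAt_rightDeriv_of_mem_interior (x := 0) (by simp)
  rw [hasDerivWithinAt_iff_tendsto_slope' (by simp)] at hd
  refine ⟨_, hd.congr fun t => ?_⟩
  simp [slope_def_field]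

theorem tendsto_norm_add_smul_add_smul_self_sub_div {X : Type*} [NormedAddCommGroup X]
    [NormedSpace ℝ X] {x y : X} {p : ℝ}
    (h : Tendsto (fun t : ℝ => (‖x + t • y‖ - ‖x‖) / t) (nhdsWithin 0 (Set.Ioi 0)) (nhds p))
    (θ : ℝ) :
    Tendsto (fun t : ℝ => (‖x + t • (y + θ • x)‖ - ‖x‖) / t)
      (nhdsWithin 0 (Set.Ioi 0)) (nhds (p + θ * ‖x‖)) := by
  have hpos : ∀ᶠ t : ℝ in nhdsWithin 0 (Set.Ioi 0), 0 < 1 + t * θ := by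
    refine nhdsWithin_le_nhds ?_
    have hc : ContinuousAt (fun t : ℝ => 1 + t * θ) 0 := by fun_prop
    exact hc.eventually (lt_mem_nhds (by simp))
  have hs : Tendsto (fun t : ℝ => t / (1 + t * θ)) (nhdsWithin 0 (Set.Ioi 0))
      (nhdsWithin 0 (Set.Ioi 0)) := by
    refine tendsto_nhdsWithin_iff.2 ⟨tendsto_nhdsWithin_of_tendsto_nhds ?_, ?_⟩
    · have hc : ContinuousAt (fun t : ℝ => t / (1 + t * θ)) 0 :=
        ContinuousAt.div (by fun_prop) (by fun_prop) (by simp)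
      simpa using hc.tendsto
    · filter_upwards [hpos, self_mem_nhdsWithin] with t ht ht0
      exact div_pos ht0 ht
  refine ((h.comp hs).add_const (θ * ‖x‖)).congr' ?_
  filter_upwards [hpos, self_mem_nhdsWithin] with t ht ht0
  have ht0' : t ≠ 0 := ne_of_gt ht0
  have hv : x + t • (y + θ • x) = (1 + t * θ) • (x + (t / (1 + t * θ)) • y) := by
    rw [smul_add (1 + t * θ), smul_smul, mul_div_cancel₀ _ ht.ne']
    module
  rw [hv, norm_smul, Real.norm_of_nonneg ht.le, Function.comp_apply]
  field_simp
  ring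

theorem canonical_one_sided_limits (X : Type*) [NormedAddCommGroup X] [NormedSpace ℝ X]
    (x y : X) (hx : x ≠ 0) :
    ∃ θ : ℝ,
      Tendsto (fun t : ℝ => (‖x - t • y‖ - ‖x + t • y‖) / (2 * t * ‖x‖))
        (nhdsWithin 0 (Set.Ioi 0)) (nhds θ) ∧
      ∃ c : ℝ,
        Tendsto (fun t : ℝ => (‖x + t • (y + θ • x)‖ - ‖x‖) / t)
          (nhdsWithin 0 (Set.Ioi 0)) (nhds c) ∧
        Tendsto (fun t : ℝ => (‖x - t • (y + θ • x)‖ - ‖x‖) / t)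
          (nhdsWithin 0 (Set.Ioi 0)) (nhds c) ∧
        Tendsto (fun t : ℝ => (‖x + t • (y + θ • x)‖ + ‖x - t • (y + θ • x)‖ - 2 * ‖x‖) / (2 * t))
          (nhdsWithin 0 (Set.Ioi 0)) (nhds c) := by
  have hn : ‖x‖ ≠ 0 := norm_ne_zero_iff.2 hx
  obtain ⟨p, hp⟩ := exists_tendsto_norm_add_smul_sub_div x y
  obtain ⟨q, hq⟩ := exists_tendsto_norm_add_smul_sub_div x (-y)
  obtain ⟨θ, hθ⟩ : ∃ θ : ℝ, θ = (q - p) / (2 * ‖x‖) := ⟨_, rfl⟩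
  have hθx : θ * ‖x‖ = (q - p) / 2 := by rw [hθ]; field_simp
  have hplus : Tendsto (fun t : ℝ => (‖x + t • (y + θ • x)‖ - ‖x‖) / t)
      (nhdsWithin 0 (Set.Ioi 0)) (nhds ((p + q) / 2)) := by
    convert tendsto_norm_add_smul_add_smul_self_sub_div hp θ using 2
    rw [hθx]; ring
  have hminus : Tendsto (fun t : ℝ => (‖x - t • (y + θ • x)‖ - ‖x‖) / t)
      (nhdsWithin 0 (Set.Ioi 0)) (nhds ((p + q) / 2)) := by
    convert tendsto_norm_add_smul_add_smul_self_sub_div hq (-θ) using 2 with t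
    · congr 3
      module
    · rw [neg_mul, hθx]; ring
  refine ⟨θ, ?_, (p + q) / 2, hplus, hminus, ?_⟩
  · rw [hθ]
    refine ((hq.sub hp).div_const (2 * ‖x‖)).congr' ?_
    filter_upwards [self_mem_nhdsWithin] with t ht
    have ht0 : t ≠ 0 := ne_of_gt ht
    rw [smul_neg, ← sub_eq_add_neg]
    field_simp
    ring
  · have h := (hplus.add hminus).div_const 2
    rw [add_self_div_two] at h
    refine h.congr' ?_
    filter_upwards [self_mem_nhdsWithin] with t ht
    have ht0 : t ≠ 0 := ne_of_gt ht
    field_simp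
    ring
end
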